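/- arXiv:math/0106089 — 2 statements merged into one kernel-verified Lean document; each statement's English description precedes it below -/
import Mathlib

section
/- Let K be an algebraically closed field of characteristic 2 and let A, B ∈ K with λ := B + A² + A + 1 ≠ 0. Then the ideal of K[x₀,x₁,x₂,x₃,x₄] generated by the three homogeneous polynomials σ₁ + x₀, σ₃ + (A+1)x₀³ + σ₂x₀ and σ₄ + (B+A)x₀⁴ + (A+1)σ₂x₀² has prime radical; equivalently, its vanishing locus (the projective curve C of degree 12 in P⁴) is irreducible. -/
namespace CurveTower

universe u

open Polynomial

section Coefficients

variable {R S : Type*} [CommRing R] [CommRing S]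

/-- The polynomial `(T² + s)(T² + eT + a) + l`, expanded. -/
noncomputable def quartic (e a l s : R) : R[X] :=
  .X ^ 4 + .C e * .X ^ 3 + .C (s + a) * .X ^ 2 + .C (e * s) * .X + .C (a * s + l)

/-- The quotient of `quartic e a l s` by `T + u` in characteristic 2, where `u` is a root. -/
noncomputable def cubic (e a s u : R) : R[X] :=
  .X ^ 3 + .C (e + u) * .X ^ 2 + .C (s + u ^ 2 + e * u + a) * .X +
    .C ((e + u) * s + u * (u ^ 2 + e * u + a))

/-- The quotient of `cubic e a s u` by `T + v` in characteristic 2, where `v` is a root. -/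
noncomputable def quadratic (e a s u v : R) : R[X] :=
  .X ^ 2 + .C (e + u + v) * .X + .C (s + u ^ 2 + e * u + a + (e + u) * v + v ^ 2)

lemma quartic_monic (e a l s : R) : (quartic e a l s).Monic := by
  unfold quartic; monicity!

lemma cubic_monic (e a s u : R) : (cubic e a s u).Monic := by
  unfold cubic; monicity!

lemma quadratic_monic (e a s u v : R) : (quadratic e a s u v).Monic := by
  unfold quadratic; monicity!

lemma natDegree_cubic [Nontrivial R] (e a s u : R) : (cubic e a s u).natDegree = 3 := by
  unfold cubic; compute_degree!

lemma natDegree_quadratic [Nontrivial R] (e a s u v : R) :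
    (quadratic e a s u v).natDegree = 2 := by
  unfold quadratic; compute_degree!

lemma eval₂_quartic (i : R →+* S) (e a l s : R) (x : S) :
    (quartic e a l s).eval₂ i x =
      x ^ 4 + i e * x ^ 3 + (i s + i a) * x ^ 2 + i e * i s * x + (i a * i s + i l) := by
  simp [quartic]

lemma eval₂_cubic (i : R →+* S) (e a s u : R) (x : S) :
    (cubic e a s u).eval₂ i x =
      x ^ 3 + (i e + i u) * x ^ 2 + (i s + i u ^ 2 + i e * i u + i a) * x +
        ((i e + i u) * i s + i u * (i u ^ 2 + i e * i u + i a)) := by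
  simp [cubic, eval₂_pow]

lemma eval₂_quadratic (i : R →+* S) (e a s u v : R) (x : S) :
    (quadratic e a s u v).eval₂ i x =
      x ^ 2 + (i e + i u + i v) * x +
        (i s + i u ^ 2 + i e * i u + i a + (i e + i u) * i v + i v ^ 2) := by
  simp [quadratic, eval₂_pow]

lemma map_cubic (i : R →+* S) (e a s u : R) :
    (cubic e a s u).map i = cubic (i e) (i a) (i s) (i u) := by
  simp [cubic]

lemma map_quadratic (i : R →+* S) (e a s u v : R) :
    (quadratic e a s u v).map i = quadratic (i e) (i a) (i s) (i u) (i v) := by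
  simp [quadratic]

lemma adjoinRoot_map_injective {i : R →+* S} (hi : Function.Injective i) {g : R[X]}
    (hg : g.Monic) :
    Function.Injective (AdjoinRoot.map i g (g.map i) dvd_rfl) := by
  rw [injective_iff_map_eq_zero]
  intro x
  induction x using AdjoinRoot.induction_on with
  | ih p =>
    intro hp
    rw [AdjoinRoot.map, AdjoinRoot.lift_mk, ← eval₂_map, ← AdjoinRoot.algebraMap_eq, ← aeval_def,
      AdjoinRoot.aeval_eq, AdjoinRoot.mk_eq_zero, map_dvd_map i hi hg] at hp
    exact AdjoinRoot.mk_eq_zero.mpr hp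

end Coefficients

section FunctionField

lemma quadraticFactor_not_isUnit {k : Type*} [Field k] (e a : k) :
    ¬ IsUnit (X ^ 2 + C e * X + C a : k[X]) := by
  apply not_isUnit_of_natDegree_pos
  have : (X ^ 2 + C e * X + C a : k[X]).natDegree = 2 := by compute_degree!
  omega

variable {k F : Type*} [Field k] [CharP k 2] [Field F] [Algebra k[X] F] [IsFractionRing k[X] F]

lemma quadraticFactor_squarefree {e : k} (he : e ≠ 0) (a : k) :
    Squarefree (X ^ 2 + C e * X + C a : k[X]) := by
  apply Separable.squarefree
  have hd : derivative (X ^ 2 + C e * X + C a : k[X]) = C e := by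
    simp [one_add_one_eq_two, CharTwo.two_eq_zero (R := k)]
  rw [Separable, hd]
  exact isCoprime_one_right.of_isCoprime_of_dvd_right (isUnit_C.mpr he.isUnit).dvd

lemma cubic_eval_ne_zero {e a l : k} (he : e ≠ 0) (hl : l ≠ 0) {s : F}
    (hs : (s + algebraMap k[X] F X ^ 2) *
      algebraMap k[X] F (X ^ 2 + C e * X + C a) = algebraMap k[X] F (C l)) (v : F) :
    (cubic (algebraMap k[X] F (C e)) (algebraMap k[X] F (C a)) s (algebraMap k[X] F X)).eval v
      ≠ 0 := by
  intro hv
  have h2 : (2 : k[X]) = 0 := CharTwo.two_eq_zero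
  have h2F : (2 : F) = 0 := by
    simpa only [map_ofNat, map_zero] using congrArg (algebraMap k[X] F) h2
  rw [← eval₂_id, eval₂_cubic] at hv
  simp only [RingHom.id_apply] at hv
  obtain ⟨m, n, hmn, rfl⟩ := IsFractionRing.exists_reduced_fraction (A := k[X]) v
  have hn0 : (n : k[X]) ≠ 0 := nonZeroDivisors.ne_zero n.2
  have hnF : algebraMap k[X] F n ≠ 0 := by simp [hn0]
  rw [IsFractionRing.mk'_eq_div] at hv
  obtain ⟨n, hn⟩ := n
  simp only at *
  have key : (X * n + m) * (X ^ 2 + C e * X + C a) * (m ^ 2 + C e * m * n + C a * n ^ 2) =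
      C l * (X * n + m + C e * n) * n ^ 2 := by
    apply IsFractionRing.injective k[X] F
    simp only [map_mul, map_add, map_pow] at hs hv ⊢
    generalize algebraMap k[X] F (C e) = e' at *
    generalize algebraMap k[X] F (C a) = a' at *
    generalize algebraMap k[X] F (C l) = l' at *
    generalize algebraMap k[X] F X = u at *
    generalize algebraMap k[X] F m = m' at *
    generalize algebraMap k[X] F n = n' at *
    field_simp at hv
    grind
  have hc : IsCoprime m n := hmn.isCoprime
  have h1 : n ^ 2 ∣ X ^ 2 + C e * X + C a := by
    have c1 : IsCoprime (n ^ 2) (X * n + m) := by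
      apply IsCoprime.pow_left
      rw [add_comm]; exact (IsCoprime.add_mul_right_left hc X).symm
    have c2 : IsCoprime (n ^ 2) (m ^ 2 + C e * m * n + C a * n ^ 2) := by
      apply IsCoprime.pow_left
      rw [show m ^ 2 + C e * m * n + C a * n ^ 2 = m ^ 2 + (C e * m + C a * n) * n by ring]
      exact (IsCoprime.add_mul_right_left (hc.pow_left (m := 2)) _).symm
    exact c1.dvd_of_dvd_mul_left (c2.dvd_of_dvd_mul_right ⟨_, key.trans (mul_comm _ _)⟩)
  have hu : IsUnit n := quadraticFactor_squarefree he a n (by rwa [← sq])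
  obtain ⟨c, hc0, rfl⟩ := Polynomial.isUnit_iff.mp hu
  have hc0' := hc0.ne_zero
  obtain ⟨m, rfl⟩ : ∃ m', m = m' * C c := ⟨m * C c⁻¹, by
    rw [mul_assoc, ← C_mul, inv_mul_cancel₀ hc0', C_1, mul_one]⟩
  have key2 : (X + m) * (X ^ 2 + C e * X + C a) * (m ^ 2 + C e * m + C a) =
      C l * (X + m + C e) := by
    have : C c ^ 3 ≠ (0 : k[X]) := pow_ne_zero _ hn0
    apply mul_left_cancel₀ this
    linear_combination key
  by_cases hxm : X + m = 0
  · rw [hxm] at key2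
    simp [he, hl] at key2
  have hq0 : (X ^ 2 + C e * X + C a : k[X]) ≠ 0 := (quadraticFactor_squarefree he a).ne_zero
  by_cases hqm : m ^ 2 + C e * m + C a = 0
  · rw [hqm, mul_zero, eq_comm, mul_eq_zero, or_iff_right (by simpa using hl)] at key2
    apply hq0
    grind
  have hd := congrArg natDegree key2
  rw [natDegree_mul (mul_ne_zero hxm hq0) hqm, natDegree_mul hxm hq0, natDegree_C_mul hl,
    natDegree_add_C (p := X + m)] at hd
  have : (X ^ 2 + C e * X + C a : k[X]).natDegree = 2 := by compute_degree!
  omega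

lemma resolvent_numerator_ne_zero {e a l : k} (he : e ≠ 0) (hl : l ≠ 0) (N r z : k[X])
    (q : k[X]) (hq : q = X ^ 2 + C e * X + C a) (hN : N = C l ^ 3 + q * r) {n : k[X]} (hn : n ≠ 0)
    (hz : q ^ 3 * z ^ 2 + C e * q ^ 4 * z * n + N * n ^ 2 = 0) (hc : IsCoprime z n) : False := by
  obtain ⟨p, hp, q', hpq⟩ := WfDvdMonoid.exists_irreducible_factor
    (hq ▸ quadraticFactor_not_isUnit e a) (hq ▸ (quadraticFactor_squarefree he a).ne_zero)
  have hp := hp.prime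
  have hp0 := hp.ne_zero
  have hpq' : ¬ p ∣ q' := by
    rintro ⟨t, rfl⟩
    apply hp.not_isUnit
    apply quadraticFactor_squarefree he a
    exact ⟨t, by rw [← hq, hpq]; ring⟩
  have hpN : ¬ p ∣ N := by
    intro h
    rw [hN, hpq, mul_assoc, dvd_add_left (dvd_mul_right _ _)] at h
    apply hp.not_isUnit
    exact isUnit_of_dvd_unit (hp.dvd_of_dvd_pow h) (by simpa using hl)
  have step : ∀ t, p ∣ N * t ^ 2 → p ∣ t := fun t h =>
    hp.dvd_of_dvd_pow ((hp.dvd_or_dvd h).resolve_left hpN)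
  subst hpq
  obtain ⟨n, rfl⟩ : p ∣ n := step n ⟨-(p ^ 2 * q' ^ 3 * z ^ 2 + C e * p ^ 3 * q' ^ 4 * z * n), by
    linear_combination hz⟩
  obtain ⟨n, rfl⟩ : p ∣ n := step n ⟨-(q' ^ 3 * z ^ 2 + C e * p ^ 2 * q' ^ 4 * z * n), by
    apply mul_left_cancel₀ (pow_ne_zero 2 hp0); linear_combination hz⟩
  have h : p ∣ q' ^ 3 * z ^ 2 := ⟨-(C e * p ^ 2 * q' ^ 4 * z * n + N * n ^ 2), by
    apply mul_left_cancel₀ (pow_ne_zero 3 hp0); linear_combination hz⟩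
  rcases hp.dvd_or_dvd h with h | h
  · exact hpq' (hp.dvd_of_dvd_pow h)
  · exact hp.not_isUnit (hc.isUnit_of_dvd' (hp.dvd_of_dvd_pow h) (dvd_mul_right _ _))

lemma resolvent_ne_zero {e a l : k} (he : e ≠ 0) (hl : l ≠ 0) {s : F}
    (hs : (s + algebraMap k[X] F X ^ 2) *
      algebraMap k[X] F (X ^ 2 + C e * X + C a) = algebraMap k[X] F (C l)) (z e' u q : F)
    (he' : e' = algebraMap k[X] F (C e)) (hu : u = algebraMap k[X] F X)
    (hq : q = algebraMap k[X] F (X ^ 2 + C e * X + C a)) :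
    z ^ 2 + e' * q * z + ((e' + u) ^ 3 * ((e' + u) * s + u * q) + (s + q) ^ 3 +
      ((e' + u) * s + u * q) ^ 2) ≠ 0 := by
  intro hz
  have h2 : (2 : k[X]) = 0 := CharTwo.two_eq_zero
  have h2F : (2 : F) = 0 := by
    simpa only [map_ofNat, map_zero] using congrArg (algebraMap k[X] F) h2
  obtain ⟨m, n, hmn, rfl⟩ := IsFractionRing.exists_reduced_fraction (A := k[X]) z
  have hn0 : (n : k[X]) ≠ 0 := nonZeroDivisors.ne_zero n.2
  have hnF : algebraMap k[X] F n ≠ 0 := by simp [hn0]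
  rw [IsFractionRing.mk'_eq_div] at hz
  obtain ⟨n, hn⟩ := n
  simp only at *
  set Q : k[X] := X ^ 2 + C e * X + C a with hQ
  have hN : (C e + X) ^ 3 * Q ^ 2 * ((C e + X) * (C l + X ^ 2 * Q) + X * Q ^ 2) +
      (C l + X ^ 2 * Q + Q ^ 2) ^ 3 + Q * ((C e + X) * (C l + X ^ 2 * Q) + X * Q ^ 2) ^ 2 =
      C l ^ 3 + Q * ((C e + X) ^ 3 * Q * ((C e + X) * (C l + X ^ 2 * Q) + X * Q ^ 2) +
        (X ^ 2 + Q) * ((C l + X ^ 2 * Q + Q ^ 2) ^ 2 + (C l + X ^ 2 * Q + Q ^ 2) * C l + C l ^ 2) +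
        ((C e + X) * (C l + X ^ 2 * Q) + X * Q ^ 2) ^ 2) := by ring
  refine resolvent_numerator_ne_zero he hl _ _ m Q hQ hN hn0 ?_ hmn.isCoprime
  apply IsFractionRing.injective k[X] F
  have hqs : q * s = algebraMap k[X] F (C l) + u ^ 2 * q := by
    rw [hq, hu]; linear_combination hs - h2F * algebraMap k[X] F Q * algebraMap k[X] F X ^ 2
  simp only [map_mul, map_add, map_pow, map_zero]
  rw [← he', ← hu, ← hq, ← hqs]
  field_simp at hz
  linear_combination q ^ 3 * hz

end FunctionField

section Descent

variable {F L : Type*} [Field F] [CharP F 2] [Field L] [Algebra F L]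

lemma exists_resolvent_root (hd : Module.finrank F L = 3) (e a s u : F) (v w : L)
    (hv : (cubic e a s u).eval₂ (algebraMap F L) v = 0)
    (hw : (quadratic (algebraMap F L e) (algebraMap F L a) (algebraMap F L s)
      (algebraMap F L u) v).eval w = 0) :
    ∃ z : F, z ^ 2 + e * (u ^ 2 + e * u + a) * z +
      ((e + u) ^ 3 * ((e + u) * s + u * (u ^ 2 + e * u + a)) + (s + (u ^ 2 + e * u + a)) ^ 3 +
      ((e + u) * s + u * (u ^ 2 + e * u + a)) ^ 2) = 0 := by
  have h2 : (2 : F) = 0 := CharTwo.two_eq_zero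
  have h2L : (2 : L) = 0 := by
    simpa only [map_ofNat, map_zero] using congrArg (algebraMap F L) h2
  have : FiniteDimensional F L := Module.finite_of_finrank_pos (by omega)
  rw [eval₂_cubic] at hv
  rw [← eval₂_id, eval₂_quadratic] at hw
  simp only [RingHom.id_apply] at hw
  set S := e * (u ^ 2 + e * u + a) with hS
  set Q := (e + u) ^ 3 * ((e + u) * s + u * (u ^ 2 + e * u + a)) +
    (s + (u ^ 2 + e * u + a)) ^ 3 + ((e + u) * s + u * (u ^ 2 + e * u + a)) ^ 2 with hQ
  obtain ⟨z, hz⟩ : ∃ z : L, z ^ 2 + algebraMap F L S * z + algebraMap F L Q = 0 := by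
    refine ⟨v ^ 2 * w + w ^ 2 * (algebraMap F L e + algebraMap F L u + v + w) +
      (algebraMap F L e + algebraMap F L u + v + w) ^ 2 * v, ?_⟩
    rw [hS, hQ]
    simp only [map_mul, map_add, map_pow]
    generalize algebraMap F L e = e' at *
    generalize algebraMap F L a = a' at *
    generalize algebraMap F L s = s' at *
    generalize algebraMap F L u = u' at *
    grind
  have hdvd : minpoly F z ∣ (X ^ 2 + C S * X + C Q : F[X]) := minpoly.dvd _ _ (by simpa using hz)
  have hdeg : (X ^ 2 + C S * X + C Q : F[X]).natDegree = 2 := by compute_degree!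
  have hle : (minpoly F z).natDegree ≤ 2 := by
    rw [← hdeg]
    exact natDegree_le_of_dvd hdvd (ne_zero_of_natDegree_gt (n := 0) (by omega))
  have h3 : (minpoly F z).natDegree ∣ 3 := hd ▸ minpoly.degree_dvd (Algebra.IsIntegral.isIntegral z)
  have h1 : (minpoly F z).natDegree = 1 := by
    generalize (minpoly F z).natDegree = d at *
    interval_cases d <;> omega
  obtain ⟨y, rfl⟩ := minpoly.natDegree_eq_one_iff.mp h1
  refine ⟨y, (algebraMap F L).injective ?_⟩
  simpa using hz

end Descent

section RootTriple

variable {S : Type*} [CommRing S]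

/-- `u`, `v`, `w` are successively roots of the quartic, the cubic and the quadratic. -/
def IsRootTriple (e a l s u v w : S) : Prop :=
  (u ^ 4 + e * u ^ 3 + (s + a) * u ^ 2 + e * s * u + (a * s + l) = 0) ∧
  (v ^ 3 + (e + u) * v ^ 2 + (s + u ^ 2 + e * u + a) * v +
    ((e + u) * s + u * (u ^ 2 + e * u + a)) = 0) ∧
  (w ^ 2 + (e + u + v) * w + (s + u ^ 2 + e * u + a + (e + u) * v + v ^ 2) = 0)

lemma IsRootTriple.symmetric_relations (h2 : (2 : S) = 0) {A B e s u v w t : S}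
    (h : IsRootTriple e ((A + 1) * e ^ 2) ((B + A ^ 2 + A + 1) * e ^ 4) s u v w)
    (ht : t = e + u + v + w) :
    (u + v + w + t + e = 0) ∧
    (u * v * w + u * v * t + u * w * t + v * w * t + (A + 1) * e ^ 3 +
      (u * v + u * w + u * t + v * w + v * t + w * t) * e = 0) ∧
    (u * v * w * t + (B + A) * e ^ 4 +
      (A + 1) * (u * v + u * w + u * t + v * w + v * t + w * t) * e ^ 2 = 0) := by
  obtain ⟨h₁, h₂, h₃⟩ := h
  subst ht
  refine ⟨by linear_combination (e + u + v + w) * h2, ?_, ?_⟩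
  · linear_combination (norm := skip) h₂ + (v + e + u) * h₃
    clear h₁ h₂ h₃
    grind
  · linear_combination (norm := skip) h₁ + u * h₂ + (u * v + (A + 1) * e ^ 2) * h₃
    clear h₁ h₂ h₃
    grind

lemma isRootTriple_of_symmetric_relations (h2 : (2 : S) = 0) {A B e u v w t : S}
    (h₁ : u + v + w + t + e = 0)
    (h₂ : u * v * w + u * v * t + u * w * t + v * w * t + (A + 1) * e ^ 3 +
      (u * v + u * w + u * t + v * w + v * t + w * t) * e = 0)
    (h₃ : u * v * w * t + (B + A) * e ^ 4 +
      (A + 1) * (u * v + u * w + u * t + v * w + v * t + w * t) * e ^ 2 = 0) :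
    IsRootTriple e ((A + 1) * e ^ 2) ((B + A ^ 2 + A + 1) * e ^ 4)
      (u * v + u * w + u * t + v * w + v * t + w * t + (A + 1) * e ^ 2) u v w := by
  obtain rfl : t = e + u + v + w := by linear_combination h₁ - (e + u + v + w) * h2
  have h : w ^ 2 + (e + u + v) * w + ((u * v + u * w + u * (e + u + v + w) + v * w +
      v * (e + u + v + w) + w * (e + u + v + w) + (A + 1) * e ^ 2) + u ^ 2 + e * u +
      (A + 1) * e ^ 2 + (e + u) * v + v ^ 2) = 0 := by
    clear h₁ h₂ h₃
    grind
  have h' : v ^ 3 + (e + u) * v ^ 2 + ((u * v + u * w + u * (e + u + v + w) + v * w +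
      v * (e + u + v + w) + w * (e + u + v + w) + (A + 1) * e ^ 2) + u ^ 2 + e * u +
      (A + 1) * e ^ 2) * v + ((e + u) * (u * v + u * w + u * (e + u + v + w) + v * w +
      v * (e + u + v + w) + w * (e + u + v + w) + (A + 1) * e ^ 2) +
      u * (u ^ 2 + e * u + (A + 1) * e ^ 2)) = 0 := by
    linear_combination (norm := skip) h₂
    clear h₁ h₂ h₃ h
    grind
  refine ⟨?_, h', h⟩
  linear_combination (norm := skip) h₃ + u * h'
  clear h₁ h₂ h₃ h h'
  grind

end RootTriple

section Tower

variable {P : Type*} [CommRing P] [IsDomain P]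

/-- The quartic over `P[s]` with `s` the indeterminate. -/
noncomputable def genericQuartic (e a l : P) : P[X][X] :=
  quartic (C e) (C a) (C l) X

/-- The cubic satisfied by a second root of `genericQuartic`. -/
noncomputable def genericCubic (e a l : P) : (AdjoinRoot (genericQuartic e a l))[X] :=
  cubic (AdjoinRoot.of _ (C e)) (AdjoinRoot.of _ (C a)) (AdjoinRoot.of _ X) (AdjoinRoot.root _)

/-- The quadratic satisfied by a third root of `genericQuartic`. -/
noncomputable def genericQuadratic (e a l : P) : (AdjoinRoot (genericCubic e a l))[X] :=
  quadratic (AdjoinRoot.of _ (AdjoinRoot.of _ (C e))) (AdjoinRoot.of _ (AdjoinRoot.of _ (C a)))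
    (AdjoinRoot.of _ (AdjoinRoot.of _ X)) (AdjoinRoot.of _ (AdjoinRoot.root _)) (AdjoinRoot.root _)

/-- Inverting the quadratic factor expresses `s` in terms of the root, so a ring homomorphism
from the quartic extension is injective as soon as it is so on polynomials in the root. -/
lemma injective_of_quartic {F : Type*} [CommRing F] {e a l : P} (hl : l ≠ 0)
    (i : AdjoinRoot (genericQuartic e a l) →+* F)
    (hi : ∀ p : P[X], i (p.eval₂ ((AdjoinRoot.of _).comp C) (AdjoinRoot.root _)) = 0 → p = 0) :
    Function.Injective i := by
  let g := genericQuartic e a l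
  set T : P[X] →+* AdjoinRoot g :=
    eval₂RingHom ((AdjoinRoot.of g).comp C) (AdjoinRoot.root g) with hT
  set q : AdjoinRoot g := T (X ^ 2 + C e * X + C a) with hq
  have TC : ∀ c, T (C c) = AdjoinRoot.of g (C c) := by simp [hT]
  have TX : T X = AdjoinRoot.root g := by simp [hT]
  have hroot : (AdjoinRoot.of g X + AdjoinRoot.root g ^ 2) * q = - T (C l) := by
    have h := (eval₂_quartic (AdjoinRoot.of g) (C e) (C a) (C l) X (AdjoinRoot.root g)).symm.trans
      (AdjoinRoot.eval₂_root g)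
    simp only [hq, map_add, map_mul, map_pow, TC, TX]
    linear_combination h
  have hmul : ∀ x y, (∃ (N : ℕ) (p : P[X]), q ^ N * x = T p) →
      (∃ (N : ℕ) (p : P[X]), q ^ N * y = T p) → ∃ (N : ℕ) (p : P[X]), q ^ N * (x * y) = T p := by
    rintro x y ⟨N, p, hp⟩ ⟨M, r, hr⟩
    exact ⟨N + M, p * r, by rw [map_mul, ← hp, ← hr]; ring⟩
  have hadd : ∀ x y, (∃ (N : ℕ) (p : P[X]), q ^ N * x = T p) →
      (∃ (N : ℕ) (p : P[X]), q ^ N * y = T p) → ∃ (N : ℕ) (p : P[X]), q ^ N * (x + y) = T p := by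
    rintro x y ⟨N, p, hp⟩ ⟨M, r, hr⟩
    refine ⟨N + M, (X ^ 2 + C e * X + C a) ^ M * p + (X ^ 2 + C e * X + C a) ^ N * r, ?_⟩
    rw [map_add, map_mul, map_mul, ← hp, ← hr, map_pow, map_pow, ← hq]; ring
  have hbase : ∀ c : P[X], ∃ (N : ℕ) (p : P[X]), q ^ N * AdjoinRoot.of g c = T p := by
    intro c
    induction c using Polynomial.induction_on with
    | C c => exact ⟨0, C c, by simp [TC]⟩
    | add c d hc hd => rw [map_add]; exact hadd _ _ hc hd
    | monomial n c h =>
      rw [pow_succ, ← mul_assoc, map_mul]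
      refine hmul _ _ h ⟨1, - C l - X ^ 2 * (X ^ 2 + C e * X + C a), ?_⟩
      rw [map_sub, map_mul, map_neg, ← hq, map_pow, TX]
      linear_combination hroot
  have hall : ∀ x : AdjoinRoot g, ∃ (N : ℕ) (p : P[X]), q ^ N * x = T p := by
    intro x
    induction x using AdjoinRoot.induction_on with
    | ih f =>
      induction f using Polynomial.induction_on with
      | C c => exact hbase c
      | add c d hc hd => rw [map_add]; exact hadd _ _ hc hd
      | monomial n c h =>
        rw [pow_succ, ← mul_assoc, map_mul]
        exact hmul _ _ h ⟨0, X, by rw [TX, pow_zero, one_mul, AdjoinRoot.mk_X]⟩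
  rw [injective_iff_map_eq_zero]
  intro x hx
  obtain ⟨N, p, hp⟩ := hall x
  have hp0 : p = 0 := hi p (by
    change i (T p) = 0
    rw [← hp, map_mul, hx, mul_zero])
  rw [hp0, map_zero] at hp
  have hlx : (C (-l) : P[X]) ^ N • x = 0 := by
    rw [Algebra.smul_def, AdjoinRoot.algebraMap_eq, map_pow, ← TC, map_neg, map_neg]
    have : - T (C l) = (AdjoinRoot.of g X + AdjoinRoot.root g ^ 2) * q := by
      rw [hroot]
    rw [this, mul_pow, mul_assoc, hp, mul_zero]
  have : Module.Free P[X] (AdjoinRoot g) := (quartic_monic _ _ _ _).free_adjoinRoot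
  exact (smul_eq_zero.mp hlx).resolve_left (pow_ne_zero _ (by simpa using hl))

/-- Irreducibility of the cubic and of the quadratic over fields containing the base makes the
whole tower a domain. -/
lemma isDomain_adjoinRoot_quadratic {R F : Type*} [CommRing R] [Field F] {i : R →+* F}
    (hi : Function.Injective i) (e a s u : R)
    (hc : Irreducible (cubic (i e) (i a) (i s) (i u)))
    (hq : Irreducible (quadratic (AdjoinRoot.of (cubic (i e) (i a) (i s) (i u)) (i e))
      (AdjoinRoot.of _ (i a)) (AdjoinRoot.of _ (i s)) (AdjoinRoot.of _ (i u))
      (AdjoinRoot.root _))) :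
    IsDomain (AdjoinRoot (quadratic (AdjoinRoot.of (cubic e a s u) e)
      (AdjoinRoot.of _ a) (AdjoinRoot.of _ s) (AdjoinRoot.of _ u) (AdjoinRoot.root _))) := by
  rw [← map_cubic] at hc hq
  have : Fact (Irreducible ((cubic e a s u).map i)) := ⟨hc⟩
  set j := AdjoinRoot.map i (cubic e a s u) ((cubic e a s u).map i) dvd_rfl with hj
  have hjinj : Function.Injective j := adjoinRoot_map_injective hi (cubic_monic _ _ _ _)
  have hjr : j (AdjoinRoot.root _) = AdjoinRoot.root _ := by simp [hj]
  have hjo : ∀ x, j (AdjoinRoot.of _ x) = AdjoinRoot.of _ (i x) := by simp [hj]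
  rw [← hjr, ← hjo, ← hjo, ← hjo, ← hjo, ← map_quadratic] at hq
  have : Fact (Irreducible _) := ⟨hq⟩
  exact (adjoinRoot_map_injective hjinj (quadratic_monic _ _ _ _ _)).isDomain _

lemma isDomain_tower [CharP P 2] {e a l : P} (he : e ≠ 0) (hl : l ≠ 0) :
    IsDomain (AdjoinRoot (genericQuadratic e a l)) := by
  let g := genericQuartic e a l
  let o := AdjoinRoot.of g
  let k := FractionRing P
  let F := FractionRing k[X]
  have : CharP k 2 := charP_of_injective_algebraMap (IsFractionRing.injective P k) 2
  have : CharP F 2 := charP_of_injective_algebraMap (IsFractionRing.injective k[X] F) 2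
  have h2F : (2 : F) = 0 := CharTwo.two_eq_zero
  let e' : k := algebraMap P k e
  let a' : k := algebraMap P k a
  let l' : k := algebraMap P k l
  have he' : e' ≠ 0 := by simpa [e'] using he
  have hl' : l' ≠ 0 := by simpa [l'] using hl
  let ι : P →+* F := ((algebraMap k[X] F).comp C).comp (algebraMap P k)
  let q : F := algebraMap k[X] F (X ^ 2 + C e' * X + C a')
  let u : F := algebraMap k[X] F X
  have hq : q ≠ 0 :=
    (map_ne_zero_iff _ (IsFractionRing.injective k[X] F)).mpr
      (quadraticFactor_squarefree he' a').ne_zero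
  let s : F := u ^ 2 + ι l / q
  have hqu : q = u ^ 2 + ι e * u + ι a := by simp [q, u, ι, e', a']
  have hs : (s + u ^ 2) * q = ι l := by
    have : s * q = u ^ 2 * q + ι l := by
      simp only [s]; rw [add_mul, div_mul_cancel₀ _ hq]
    linear_combination this + h2F * u ^ 2 * q
  have hg : g.eval₂ (eval₂RingHom ι s) u = 0 := by
    simp only [g, genericQuartic]
    rw [eval₂_quartic]
    simp only [coe_eval₂RingHom, eval₂_C, eval₂_X]
    rw [hqu] at hs
    linear_combination hs + h2F * ι l
  let i : AdjoinRoot g →+* F := AdjoinRoot.lift (eval₂RingHom ι s) u hg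
  have hiC : ∀ x, i (o (C x)) = ι x := by intro x; simp [i, o]
  have hiX : i (o X) = s := by simp [i, o]
  have hiu : i (AdjoinRoot.root g) = u := by simp [i]
  have hi : Function.Injective i := by
    refine injective_of_quartic hl i fun p hp => ?_
    rw [hom_eval₂, show i (AdjoinRoot.root _) = u from hiu,
      show i.comp ((AdjoinRoot.of _).comp C) = ι from RingHom.ext hiC] at hp
    have : algebraMap k[X] F (p.map (algebraMap P k)) = 0 := by
      rw [← hp]
      rw [← coe_eval₂RingHom, ← coe_mapRingHom, ← RingHom.comp_apply]
      congr 1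
      ext <;> simp [ι, u]
    rw [map_eq_zero_iff _ (IsFractionRing.injective k[X] F)] at this
    exact (Polynomial.map_eq_zero_iff (IsFractionRing.injective P k)).mp this
  have hc : Irreducible (cubic (i (o (C e))) (i (o (C a))) (i (o X)) (i (AdjoinRoot.root g))) := by
    rw [(cubic_monic _ _ _ _).irreducible_iff_roots_eq_zero_of_degree_le_three
      (by rw [natDegree_cubic]; omega) (by rw [natDegree_cubic]), Multiset.eq_zero_iff_forall_notMem]
    intro v hv
    rw [hiC, hiC, hiX, hiu] at hv
    exact cubic_eval_ne_zero he' hl' hs v (isRoot_of_mem_roots hv)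
  refine isDomain_adjoinRoot_quadratic hi _ _ _ _ hc ?_
  have := Fact.mk hc
  rw [(quadratic_monic _ _ _ _ _).irreducible_iff_roots_eq_zero_of_degree_le_three
      (by rw [natDegree_quadratic]) (by rw [natDegree_quadratic]; omega),
      Multiset.eq_zero_iff_forall_notMem]
  intro w hw
  have hfin : Module.finrank F (AdjoinRoot (cubic (i (o (C e))) (i (o (C a))) (i (o X))
      (i (AdjoinRoot.root g)))) = 3 := by
    rw [(AdjoinRoot.powerBasis hc.ne_zero).finrank, AdjoinRoot.powerBasis_dim, natDegree_cubic]
  obtain ⟨z, hz⟩ := exists_resolvent_root hfin _ _ _ _ _ w (AdjoinRoot.eval₂_root _)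
    (isRoot_of_mem_roots hw)
  rw [hiC, hiC, hiX, hiu, ← hqu] at hz
  exact resolvent_ne_zero he' hl' hs z _ _ _ rfl rfl rfl hz

/-- There is a domain carrying a universal root triple. -/
lemma exists_universal_rootTriple {P : Type u} [CommRing P] [IsDomain P] [CharP P 2] {e a l : P}
    (he : e ≠ 0) (hl : l ≠ 0) :
    ∃ (R : Type u) (_ : CommRing R) (_ : IsDomain R) (j : P[X] →+* R) (u v w : R),
      IsRootTriple (j (C e)) (j (C a)) (j (C l)) (j X) u v w ∧
      ∀ (S : Type u) [CommRing S] (f : P[X] →+* S) (u' v' w' : S),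
        IsRootTriple (f (C e)) (f (C a)) (f (C l)) (f X) u' v' w' →
        ∃ ψ : R →+* S, ψ.comp j = f ∧ ψ u = u' ∧ ψ v = v' ∧ ψ w = w' := by
  let o₁ := AdjoinRoot.of (genericQuartic e a l)
  let o₂ := AdjoinRoot.of (genericCubic e a l)
  let o₃ := AdjoinRoot.of (genericQuadratic e a l)
  refine ⟨AdjoinRoot (genericQuadratic e a l), inferInstance, isDomain_tower he hl,
    (o₃.comp o₂).comp o₁, o₃ (o₂ (AdjoinRoot.root _)), o₃ (AdjoinRoot.root _),
    AdjoinRoot.root _, ⟨?_, ?_, ?_⟩, ?_⟩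
  · have h := (eval₂_quartic o₁ (C e) (C a) (C l) X (AdjoinRoot.root _)).symm.trans
      (AdjoinRoot.eval₂_root (genericQuartic e a l))
    simpa only [RingHom.comp_apply, map_add, map_mul, map_pow, map_zero] using congrArg (o₃.comp o₂) h
  · have h := (eval₂_cubic o₂ (o₁ (C e)) (o₁ (C a)) (o₁ X) (AdjoinRoot.root _)
      (AdjoinRoot.root _)).symm.trans (AdjoinRoot.eval₂_root (genericCubic e a l))
    simpa only [RingHom.comp_apply, map_add, map_mul, map_pow, map_zero] using congrArg o₃ h
  · exact (eval₂_quadratic o₃ (o₂ (o₁ (C e))) (o₂ (o₁ (C a))) (o₂ (o₁ X))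
      (o₂ (AdjoinRoot.root _)) (AdjoinRoot.root _) (AdjoinRoot.root _)).symm.trans
      (AdjoinRoot.eval₂_root (genericQuadratic e a l))
  · rintro S _ f u' v' w' ⟨hu, hv, hw⟩
    let ψ₁ : AdjoinRoot (genericQuartic e a l) →+* S := AdjoinRoot.lift f u'
      ((eval₂_quartic f (C e) (C a) (C l) X u').trans hu)
    have h₁ : ∀ p, ψ₁ (o₁ p) = f p := fun p => AdjoinRoot.lift_of _
    have h₁' : ψ₁ (AdjoinRoot.root _) = u' := AdjoinRoot.lift_root _
    let ψ₂ : AdjoinRoot (genericCubic e a l) →+* S := AdjoinRoot.lift ψ₁ v'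
      ((eval₂_cubic ψ₁ (o₁ (C e)) (o₁ (C a)) (o₁ X) (AdjoinRoot.root _) v').trans (by
        rw [h₁', h₁, h₁, h₁]; exact hv))
    have h₂ : ∀ p, ψ₂ (o₂ p) = ψ₁ p := fun p => AdjoinRoot.lift_of _
    have h₂' : ψ₂ (AdjoinRoot.root _) = v' := AdjoinRoot.lift_root _
    let ψ₃ : AdjoinRoot (genericQuadratic e a l) →+* S := AdjoinRoot.lift ψ₂ w'
      ((eval₂_quadratic ψ₂ (o₂ (o₁ (C e))) (o₂ (o₁ (C a))) (o₂ (o₁ X)) (o₂ (AdjoinRoot.root _))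
        (AdjoinRoot.root _) w').trans (by
          rw [h₂', h₂, h₂, h₂, h₂, h₁', h₁, h₁, h₁]; exact hw))
    have h₃ : ∀ p, ψ₃ (o₃ p) = ψ₂ p := fun p => AdjoinRoot.lift_of _
    refine ⟨ψ₃, RingHom.ext fun p => ?_, ?_, ?_, AdjoinRoot.lift_root _⟩
    · simp only [RingHom.comp_apply, h₃, h₂, h₁]
    · rw [h₃, h₂, h₁']
    · rw [h₃, h₂']

end Tower

end CurveTower

open MvPolynomial

/-- for `λ = B + A² + A + 1 ≠ 0` over an algebraically closed
field of characteristic 2, the homogeneous ideal of the curve `C ⊂ P⁴`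
(generated by `σ₁ + x₀`, `σ₃ + (A+1)x₀³ + σ₂x₀` and
`σ₄ + (B+A)x₀⁴ + (A+1)σ₂x₀²`) has prime radical; equivalently, `C` is
irreducible. -/
theorem curve_irreducible
    (K : Type*) [Field K] [IsAlgClosed K] [CharP K 2] (A B : K)
    (hlam : B + A ^ 2 + A + 1 ≠ 0) :
    (Ideal.span
      {(X 1 + X 2 + X 3 + X 4 + X 0 : MvPolynomial (Fin 5) K),
       X 1 * X 2 * X 3 + X 1 * X 2 * X 4 + X 1 * X 3 * X 4 + X 2 * X 3 * X 4 +
         C (A + 1) * X 0 ^ 3 +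
         (X 1 * X 2 + X 1 * X 3 + X 1 * X 4 + X 2 * X 3 + X 2 * X 4 + X 3 * X 4)
           * X 0,
       X 1 * X 2 * X 3 * X 4 + C (B + A) * X 0 ^ 4 +
         C (A + 1) *
           (X 1 * X 2 + X 1 * X 3 + X 1 * X 4 + X 2 * X 3 + X 2 * X 4 + X 3 * X 4)
           * X 0 ^ 2}).radical.IsPrime := by
  set I : Ideal (MvPolynomial (Fin 5) K) := Ideal.span _ with hI
  suffices h : I.IsPrime from h.isRadical.radical.symm ▸ h
  obtain ⟨R, _, _, j, u, v, w, huvw, huniv⟩ := CurveTower.exists_universal_rootTriple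
    (e := (Polynomial.X : Polynomial K)) (a := Polynomial.C (A + 1) * Polynomial.X ^ 2)
    (l := Polynomial.C (B + A ^ 2 + A + 1) * Polynomial.X ^ 4) Polynomial.X_ne_zero
    (mul_ne_zero (Polynomial.C_ne_zero.mpr hlam) (pow_ne_zero _ Polynomial.X_ne_zero))
  let mk : MvPolynomial (Fin 5) K →+* MvPolynomial (Fin 5) K ⧸ I := Ideal.Quotient.mk I
  let κ : K →+* R := (j.comp Polynomial.C).comp Polynomial.C
  let κ' : K →+* MvPolynomial (Fin 5) K ⧸ I := mk.comp C
  have hκ : ∀ c, j (Polynomial.C (Polynomial.C c)) = κ c := fun _ => rfl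
  have hκ' : ∀ c, mk (C c) = κ' c := fun _ => rfl
  obtain ⟨x, hx⟩ : ∃ x, j (Polynomial.C Polynomial.X) = x := ⟨_, rfl⟩
  let φ : MvPolynomial (Fin 5) K →+* R := eval₂Hom κ ![x, u, v, w, x + u + v + w]
  have h2K : (2 : K) = 0 := CharTwo.two_eq_zero
  have h2R : (2 : R) = 0 := by simpa only [map_ofNat, map_zero] using congrArg κ h2K
  have h2Q : (2 : MvPolynomial (Fin 5) K ⧸ I) = 0 := by
    simpa only [map_ofNat, map_zero] using congrArg κ' h2K
  have φC : ∀ c, φ (C c) = κ c := by simp [φ]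
  have φ0 : φ (X 0) = x := by simp [φ]
  have φ1 : φ (X 1) = u := by simp [φ]
  have φ2 : φ (X 2) = v := by simp [φ]
  have φ3 : φ (X 3) = w := by simp [φ]
  have φ4 : φ (X 4) = x + u + v + w := by simp [φ]
  have hIφ : I ≤ RingHom.ker φ := by
    simp only [map_add, map_mul, map_pow, hκ, map_one, hx] at huvw
    obtain ⟨h₁, h₂, h₃⟩ := huvw.symmetric_relations h2R rfl
    rw [hI, Ideal.span_le]
    rintro p (rfl | rfl | rfl) <;>
    simp only [SetLike.mem_coe, RingHom.mem_ker, map_add, map_mul, map_pow, φC, φ0, φ1, φ2, φ3,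
      φ4, map_one] <;> assumption
  have hrel : ∀ p ∈ I, mk p = 0 := fun p hp => Ideal.Quotient.eq_zero_iff_mem.mpr hp
  have h₁ := hrel _ (Ideal.subset_span (Or.inl rfl))
  have h₂ := hrel _ (Ideal.subset_span (Or.inr (Or.inl rfl)))
  have h₃ := hrel _ (Ideal.subset_span (Or.inr (Or.inr rfl)))
  simp only [map_add, map_mul, map_pow, hκ', map_one] at h₁ h₂ h₃
  have hQ := CurveTower.isRootTriple_of_symmetric_relations h2Q h₁ h₂ h₃
  obtain ⟨ψ, hψj, hψu, hψv, hψw⟩ := huniv (MvPolynomial (Fin 5) K ⧸ I)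
    (Polynomial.eval₂RingHom (Polynomial.eval₂RingHom κ' (mk (X 0)))
      (mk (X 1) * mk (X 2) + mk (X 1) * mk (X 3) + mk (X 1) * mk (X 4) + mk (X 2) * mk (X 3) +
        mk (X 2) * mk (X 4) + mk (X 3) * mk (X 4) + (κ' A + 1) * mk (X 0) ^ 2))
    (mk (X 1)) (mk (X 2)) (mk (X 3)) (by
      simpa only [Polynomial.coe_eval₂RingHom, Polynomial.eval₂_C, Polynomial.eval₂_X,
        Polynomial.eval₂_mul, Polynomial.eval₂_pow, map_add, map_mul, map_pow, map_one] using hQ)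
  have hψx : ψ x = mk (X 0) := by
    rw [← hx, ← RingHom.comp_apply, hψj]; simp
  have hcomp : ψ.comp φ = mk := by
    apply MvPolynomial.ringHom_ext
    · intro c
      rw [RingHom.comp_apply, φC, ← hκ, ← RingHom.comp_apply ψ j, hψj]
      simp [κ']
    · intro i
      rw [RingHom.comp_apply]
      fin_cases i
      · exact (congrArg ψ φ0).trans hψx
      · exact (congrArg ψ φ1).trans hψu
      · exact (congrArg ψ φ2).trans hψv
      · exact (congrArg ψ φ3).trans hψw
      · refine (congrArg ψ φ4).trans (?_ : _ = mk (X 4))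
        simp only [map_add, hψx, hψu, hψv, hψw]
        linear_combination h₁ - mk (X 4) * h2Q
  have hker : I = RingHom.ker φ := by
    refine le_antisymm hIφ fun p hp => ?_
    rw [← Ideal.Quotient.eq_zero_iff_mem]
    change mk p = 0
    rw [← hcomp, RingHom.comp_apply, (RingHom.mem_ker).mp hp, map_zero]
  rw [hker]
  exact RingHom.ker_isPrime φ
end

section
/- Let q = 2^m and let A, B ∈ F_q with λ := B + A² + A + 1 ≠ 0. Then (q − 11 − 13·⌊2√q⌋)/24 ≤ N(A,B) ≤ (q + 1 + 13·⌊2√q⌋)/24. -/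
section AuxiliaryPolynomial

open Polynomial Finset

/-- The pointwise core of Stepanov's method: an auxiliary polynomial vanishing on a set of points
`x` of the field with `(2h)²` elements on which `T` satisfies a semilinear condition. -/
theorem stepanov_card_le {K : Type*} [Field K] [IsAlgClosed K] [CharP K 2]
    (r h e : ℕ) (hh : 2 ^ r = 2 * h) (h4 : 4 ≤ h) (T : K[X]) (hT0 : T ≠ 0)
    (hT : T.natDegree = e * (2 * h)) (he : e ≤ 2) (ε : K) (Z : Finset K)
    (hZ : ∀ x ∈ Z, x ≠ 0 ∧ x ^ ((2 * h) ^ 2) = x ∧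
      ∃ τ, T.eval x = x ^ h * τ ∧ τ ^ (2 * h) = τ + ε) :
    Z.card ≤ 2 * h ^ 2 + 7 * h := by
  classical
  set R := 2 * h with hR
  let ι := Fin h × Fin (h + 2) ⊕ Fin h × Fin (h + 2)
  let E : ι → K[X] := Sum.elim (fun p => X ^ (p.1.1 * R + p.2.1 + h))
    (fun p => X ^ (p.1.1 * R + p.2.1) * (T + C ε * X ^ h))
  have hmulle : ∀ i : Fin h, i.1 * R ≤ (h - 1) * R := fun i =>
    Nat.mul_le_mul_right _ (by have := i.2; omega)
  have hR1 : (h - 1) * R + R = h * R := by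
    rw [← Nat.succ_mul]; congr 1; omega
  have hR2 : (h + 1) * R = h * R + R := Nat.succ_mul _ _
  have heR : e * R ≤ 2 * R := Nat.mul_le_mul_right _ he
  have hE : ∀ i, E i ∈ degreeLT K ((h + 1) * R + h + 2) := by
    intro i
    rw [mem_degreeLT]
    refine lt_of_le_of_lt degree_le_natDegree ?_
    rw [Nat.cast_withBot, Nat.cast_withBot, WithBot.coe_lt_coe]
    rcases i with ⟨i, j⟩ | ⟨i, j⟩
    · have := hmulle i
      have := j.2
      simp only [E, Sum.elim_inl, natDegree_X_pow]
      omega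
    · have := hmulle i
      have := j.2
      simp only [E, Sum.elim_inr]
      have h1 : (T + C ε * X ^ h).natDegree ≤ 2 * R := by
        refine (natDegree_add_le _ _).trans (max_le (by omega) ?_)
        exact (natDegree_C_mul_X_pow_le _ _).trans (by omega)
      have h2 := natDegree_mul_le (p := (X ^ (i.1 * R + j.1) : K[X])) (q := T + C ε * X ^ h)
      rw [natDegree_X_pow] at h2
      omega
  let E' : ι → degreeLT K ((h + 1) * R + h + 2) := fun i => ⟨E i, hE i⟩
  have hnot : ¬ LinearIndependent K E' := by
    intro hli
    have : Module.Finite K (degreeLT K ((h + 1) * R + h + 2)) :=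
      Module.Finite.equiv (degreeLTEquiv K _).symm
    have h1 := hli.fintype_card_le_finrank
    rw [(degreeLTEquiv K _).finrank_eq] at h1
    simp only [ι, Fintype.card_sum, Fintype.card_prod, Fintype.card_fin, Module.finrank_fin_fun]
      at h1
    have : (h + 1) * R = 2 * (h * h) + 2 * h := by rw [hR]; ring
    have : h * (h + 2) = h * h + 2 * h := by ring
    omega
  obtain ⟨g, hg, i₀, hi₀⟩ := Fintype.not_linearIndependent_iff.1 hnot
  have hg' : ∑ i, g i • E i = 0 := by
    have := congrArg Subtype.val hg
    simpa [E'] using this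
  have hRpos : 0 < R := by omega
  choose b hb using fun i => IsAlgClosed.exists_pow_nat_eq (g i) hRpos
  let W : ι → K[X] := Sum.elim (fun p => X ^ (p.2.1 * R + h + p.1.1))
    (fun p => X ^ (p.2.1 * R + p.1.1) * T)
  have hW0 : ∀ i, W i ≠ 0 := by
    rintro (⟨i, j⟩ | ⟨i, j⟩)
    · exact pow_ne_zero _ X_ne_zero
    · exact mul_ne_zero (pow_ne_zero _ X_ne_zero) hT0
  have hWdeg : ∀ i, (W i).natDegree = Sum.elim (fun p : Fin h × Fin (h + 2) =>
      p.2.1 * R + h + p.1.1) (fun p => (p.2.1 + e) * R + p.1.1) i := by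
    rintro (⟨i, j⟩ | ⟨i, j⟩)
    · simp [W]
    · simp only [W, Sum.elim_inr]
      rw [natDegree_mul (pow_ne_zero _ X_ne_zero) hT0, natDegree_X_pow, hT]
      ring
  have hkey : ∀ a b c d : ℕ, c < R → d < R → a * R + c = b * R + d → a = b ∧ c = d := by
    intro a b c d hc hd hcd
    have h1 : (a * R + c) % R = (b * R + d) % R := by rw [hcd]
    rw [Nat.mul_add_mod', Nat.mul_add_mod', Nat.mod_eq_of_lt hc, Nat.mod_eq_of_lt hd] at h1
    subst h1
    exact ⟨Nat.eq_of_mul_eq_mul_right hRpos (by omega), rfl⟩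
  have hinj : Function.Injective fun i => (W i).natDegree := by
    intro x y hxy
    simp only [hWdeg] at hxy
    rcases x with ⟨i, j⟩ | ⟨i, j⟩ <;> rcases y with ⟨i', j'⟩ | ⟨i', j'⟩ <;>
      simp only [Sum.elim_inl, Sum.elim_inr, add_assoc] at hxy <;> have := i.2 <;> have := i'.2
    · obtain ⟨h1, h2⟩ := hkey _ _ _ _ (by omega) (by omega) hxy
      have h3 : i = i' := Fin.ext (by omega)
      have h4 : j = j' := Fin.ext h1
      rw [h3, h4]
    · have := hkey _ _ _ _ (by omega) (by omega) hxy
      omega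
    · have := hkey _ _ _ _ (by omega) (by omega) hxy
      omega
    · obtain ⟨h1, h2⟩ := hkey _ _ _ _ (by omega) (by omega) hxy
      have h3 : i = i' := Fin.ext h2
      have h4 : j = j' := Fin.ext (by omega)
      rw [h3, h4]
  set P : K[X] := ∑ i, C (b i) * W i with hP
  have hPdeg : P.natDegree ≤ 2 * h ^ 2 + 7 * h := by
    refine natDegree_sum_le_of_forall_le _ _ fun i _ => ?_
    refine (natDegree_C_mul_le _ _).trans ?_
    rw [hWdeg]
    have hh2 : (h + 1) * R = 2 * h ^ 2 + 2 * h := by rw [hR]; ring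
    rcases i with ⟨i, j⟩ | ⟨i, j⟩ <;> simp only [Sum.elim_inl, Sum.elim_inr]
    · have h1 := i.2
      have h2 : j.1 * R ≤ (h + 1) * R := Nat.mul_le_mul_right _ (by have := j.2; omega)
      omega
    · have h1 := i.2
      have h2 : (j.1 + e) * R ≤ (h + 1 + 2) * R := Nat.mul_le_mul_right _ (by have := j.2; omega)
      have h3 : (h + 1 + 2) * R = (h + 1) * R + 2 * R := by ring
      omega
  have hb0 : b i₀ ≠ 0 := by
    intro h0
    apply hi₀
    rw [← hb, h0, zero_pow hRpos.ne']
  have hP0 : P ≠ 0 := by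
    intro h0
    have h1 : degree P = _ := degree_sum_eq_of_disjoint (fun i => C (b i) * W i) univ (by
      rintro x ⟨-, hx⟩ y ⟨-, hy⟩ hxy
      simp only [Function.onFun, Function.comp_apply]
      have hx' : b x ≠ 0 := fun h => hx (by simp [h])
      have hy' : b y ≠ 0 := fun h => hy (by simp [h])
      rw [degree_C_mul hx', degree_C_mul hy', degree_eq_natDegree (hW0 x),
        degree_eq_natDegree (hW0 y)]
      intro h
      exact hxy (hinj (by exact_mod_cast h)))
    rw [h0, degree_zero] at h1
    have h2 : degree (C (b i₀) * W i₀) ≤ ⊥ := by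
      rw [h1]
      exact Finset.le_sup (f := fun i => degree (C (b i) * W i)) (mem_univ i₀)
    rw [le_bot_iff, degree_eq_bot] at h2
    exact mul_ne_zero (C_ne_zero.2 hb0) (hW0 i₀) h2
  refine (card_le_degree_of_subset_roots (p := P) ?_).trans hPdeg
  intro x hx
  obtain ⟨hx0, hxQ, τ, hτ, hτR⟩ := hZ x hx
  rw [mem_roots hP0, IsRoot.def]
  let S : ι → K := Sum.elim (fun p => x ^ (p.2.1 * R + p.1.1))
    (fun p => x ^ (p.2.1 * R + p.1.1) * τ)
  have hPS : P.eval x = x ^ h * ∑ i, b i * S i := by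
    rw [hP, eval_finsetSum, mul_sum]
    refine sum_congr rfl fun i _ => ?_
    rcases i with ⟨i, j⟩ | ⟨i, j⟩ <;>
      simp only [S, W, Sum.elim_inl, Sum.elim_inr, eval_mul, eval_C, eval_pow, eval_X, hτ,
        pow_add] <;> ring
  have hSE : ∀ i, x ^ h * S i ^ R = (E i).eval x := by
    have hxx : ∀ j : ℕ, (x ^ (j * R)) ^ R = x ^ j := by
      intro j
      rw [← pow_mul, show j * R * R = R ^ 2 * j by ring, pow_mul, hxQ]
    rintro (⟨i, j⟩ | ⟨i, j⟩)
    · simp only [S, E, Sum.elim_inl, eval_mul, eval_pow, eval_X, pow_add, mul_pow, hxx]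
      rw [pow_mul]; ring
    · simp only [S, E, Sum.elim_inr, eval_pow, eval_X, pow_add, mul_pow, hxx, eval_mul, eval_add,
        eval_C, hτ, hτR]
      rw [pow_mul]; ring
  have hS0 : (∑ i, b i * S i) ^ R = 0 := by
    have h1 : (∑ i, b i * S i) ^ R = ∑ i, (b i * S i) ^ R := by
      rw [← hh]; exact sum_pow_char_pow 2 r _ _
    have h2 : x ^ h * (∑ i, b i * S i) ^ R = 0 := by
      rw [h1, mul_sum]
      have := congrArg (eval x) hg'
      rw [eval_finsetSum, eval_zero] at this
      rw [← this]
      refine sum_congr rfl fun i _ => ?_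
      rw [mul_pow, hb, eval_smul, smul_eq_mul, ← hSE]
      ring
    exact (mul_eq_zero.1 h2).resolve_left (pow_ne_zero _ hx0)
  rw [hPS, eq_zero_of_pow_eq_zero hS0, mul_zero]

end AuxiliaryPolynomial

open Finset in
/-- Newton's identities for a family of elements of a commutative ring. -/
theorem newton_identity {R : Type*} [CommRing R] {D : ℕ} (y : Fin D → R) (k : ℕ) :
    (k : R) * (univ.val.map y).esymm k = (-1) ^ (k + 1) *
      ∑ j ∈ range k, (-1) ^ j * (univ.val.map y).esymm j * ∑ i, y i ^ (k - j) := by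
  have h := congrArg (MvPolynomial.aeval y) (MvPolynomial.mul_esymm_eq_sum (Fin D) R k)
  simp only [map_mul, map_natCast, MvPolynomial.aeval_esymm_eq_multiset_esymm, map_pow, map_neg,
    map_one, map_sum, MvPolynomial.psum, MvPolynomial.aeval_X] at h
  rw [h]
  congr 1
  rw [sum_filter, Finset.Nat.sum_antidiagonal_eq_sum_range_succ_mk, sum_range_succ]
  simp only [lt_irrefl, if_false, add_zero]
  exact sum_congr rfl fun j hj => if_pos (mem_range.1 hj)

open Finset in
theorem norm_esymm_le_of_norm_sum_pow_le {D : ℕ} (y : Fin D → ℂ) {C : ℝ} (hC : 0 ≤ C)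
    (hy : ∀ j, 1 ≤ j → j ≤ D → ‖∑ i, y i ^ j‖ ≤ C) (k : ℕ) (hk : k ≤ D) :
    ‖(univ.val.map y).esymm k‖ ≤ (1 + C) ^ k := by
  induction k using Nat.strong_induction_on with
  | _ k ih =>
    rcases Nat.eq_zero_or_pos k with rfl | hk0
    · simp [Multiset.esymm]
    have h := congrArg norm (newton_identity y k)
    rw [norm_mul, norm_mul, norm_pow, norm_neg, norm_one, one_pow, one_mul,
      Complex.norm_natCast] at h
    have h1 : ‖∑ j ∈ range k, (-1) ^ j * (univ.val.map y).esymm j * ∑ i, y i ^ (k - j)‖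
        ≤ ∑ j ∈ range k, (1 + C) ^ j * C := by
      refine norm_sum_le_of_le _ fun j hj => ?_
      have hj' := mem_range.1 hj
      rw [norm_mul, norm_mul, norm_pow, norm_neg, norm_one, one_pow, one_mul]
      exact mul_le_mul (ih j hj' (by omega)) (hy _ (by omega) (by omega)) (norm_nonneg _)
        (by positivity)
    rw [← sum_mul] at h1
    have h2 := geom_sum_mul (1 + C) k
    rw [add_sub_cancel_left] at h2
    rw [h2] at h1
    have h3 : (1 : ℝ) ≤ k := by exact_mod_cast hk0
    nlinarith [norm_nonneg ((univ.val.map y).esymm k)]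

open Finset Polynomial in
/-- A family of complex numbers is bounded in terms of its power sums. -/
theorem norm_le_of_norm_sum_pow_le {D : ℕ} (y : Fin D → ℂ) {C : ℝ} (hC : 0 ≤ C)
    (hy : ∀ j, 1 ≤ j → j ≤ D → ‖∑ i, y i ^ j‖ ≤ C) (i : Fin D) :
    ‖y i‖ ≤ 2 * (1 + C) := by
  by_contra! hlt
  set B := 1 + C with hB
  have hB0 : 0 < B := by positivity
  set t := ‖y i‖ with ht
  have hz : ∑ j ∈ range (D + 1), (-1 : ℂ) ^ j * ((univ.val.map y).esymm j * y i ^ (D - j)) = 0 := by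
    have h := congrArg (eval (y i)) (Multiset.prod_X_sub_X_eq_sum_esymm (univ.val.map y))
    rw [eval_multiset_prod, Multiset.map_map, Multiset.map_map, eval_finsetSum] at h
    rw [Multiset.prod_eq_zero] at h
    · rw [eq_comm]
      simpa using h
    · exact Multiset.mem_map.2 ⟨i, mem_univ_val i, by simp⟩
  rw [sum_range_succ'] at hz
  have he0 : (univ.val.map y).esymm 0 = 1 := by simp [Multiset.esymm]
  simp only [pow_zero, he0, one_mul, Nat.sub_zero] at hz
  have h1 : t ^ D ≤ ∑ j ∈ range D, B ^ (j + 1) * t ^ (D - (j + 1)) := by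
    have h2 := congrArg norm (eq_neg_of_add_eq_zero_right hz)
    rw [norm_neg, norm_pow] at h2
    rw [ht, h2]
    refine norm_sum_le_of_le _ fun j hj => ?_
    have := mem_range.1 hj
    rw [norm_mul, norm_mul, norm_pow, norm_pow, norm_neg, norm_one, one_pow, one_mul]
    exact mul_le_mul_of_nonneg_right
      (norm_esymm_le_of_norm_sum_pow_le y hC hy _ (by omega)) (by positivity)
  have ht0 : 0 < t := by linarith
  have h3 : ∀ n, n ≤ D → ∑ j ∈ range n, B ^ (j + 1) * t ^ (D - (j + 1)) ≤
      t ^ D * (1 - (1 / 2) ^ n) := by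
    intro n
    induction n with
    | zero => simp
    | succ n ih =>
      intro hn
      rw [sum_range_succ]
      have h4 : B ^ (n + 1) * t ^ (D - (n + 1)) ≤ t ^ D * (1 / 2) ^ (n + 1) := by
        have h5 : t ^ D = t ^ (n + 1) * t ^ (D - (n + 1)) := by rw [← pow_add]; congr 1; omega
        have h6 : B ^ (n + 1) ≤ (t * (1 / 2)) ^ (n + 1) :=
          pow_le_pow_left₀ hB0.le (by linarith) _
        rw [h5]
        calc _ ≤ (t * (1 / 2)) ^ (n + 1) * t ^ (D - (n + 1)) :=
              mul_le_mul_of_nonneg_right h6 (by positivity)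
          _ = _ := by rw [mul_pow]; ring
      have h7 := ih (by omega)
      have h8 : (1 / 2 : ℝ) ^ n = 2 * (1 / 2) ^ (n + 1) := by rw [pow_succ]; ring
      rw [h8] at h7
      linarith
  have h9 := h1.trans (h3 D le_rfl)
  have h10 : 0 < t ^ D * (1 / 2) ^ D := by positivity
  linarith

open Finset Polynomial in
/-- If `L = ∑ c_d T^d` is a polynomial of degree at most `D` with `L(0) = 1`, logarithmic
derivative `∑ S_k T^(k-1)`, and the even-indexed `S_k` are `O(ρ^k)`, then `|c_1| ≤ D ρ`. -/
theorem abs_coeff_one_le_of_newton {D : ℕ} (c S : ℕ → ℝ) (hc0 : c 0 = 1)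
    (hcD : ∀ d, D < d → c d = 0)
    (hN : ∀ d : ℕ, 1 ≤ d → (d : ℝ) * c d = ∑ j ∈ range d, c j * S (d - j))
    {ρ B : ℝ} (hρ : 0 < ρ) (hB : 0 ≤ B) (n₀ : ℕ)
    (hS : ∀ n, n₀ ≤ n → |S (2 * n)| ≤ B * ρ ^ (2 * n)) :
    |c 1| ≤ D * ρ := by
  let p : ℂ[X] := ∑ j ∈ range (D + 1), C (c j : ℂ) * X ^ (D - j)
  have hpcoeff : ∀ j, j ≤ D → p.coeff (D - j) = c j := by
    intro j hj
    simp only [p, finsetSum_coeff, coeff_C_mul, coeff_X_pow]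
    rw [sum_eq_single j]
    · simp
    · intro i hi hij
      have := mem_range.1 hi
      rw [if_neg (by omega), mul_zero]
    · intro h
      exact absurd (mem_range.2 (by omega)) h
  have hpdeg : p.natDegree ≤ D := natDegree_sum_le_of_forall_le _ _ fun j _ =>
    (natDegree_C_mul_X_pow_le _ _).trans (Nat.sub_le _ _)
  have hpD : p.coeff D = 1 := by simpa [hc0] using hpcoeff 0 (Nat.zero_le _)
  have hpnat : p.natDegree = D := le_antisymm hpdeg (le_natDegree_of_ne_zero (by simp [hpD]))
  have hlead : p.leadingCoeff = 1 := by rw [leadingCoeff, hpnat, hpD]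
  have hsplit : p.Splits := IsAlgClosed.splits p
  have hcard : Multiset.card p.roots = D := by rw [splits_iff_card_roots.1 hsplit, hpnat]
  obtain ⟨α, hα⟩ : ∃ α : Fin D → ℂ, univ.val.map α = p.roots := by
    generalize p.roots = s at hcard
    induction s using Quotient.inductionOn with
    | h l =>
      have hl : l.length = D := hcard
      subst hl
      exact ⟨l.get, by simp⟩
  have hes : ∀ j, j ≤ D → (univ.val.map α).esymm j = (-1) ^ j * c j := by
    intro j hj
    have h := Polynomial.coeff_eq_esymm_roots_of_splits hsplit (k := D - j) (by omega)
    rw [hpcoeff j hj, hlead, hpnat, one_mul, show D - (D - j) = j by omega] at h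
    rw [hα, h, ← mul_assoc, ← mul_pow]
    simp
  have hes' : ∀ j, (univ.val.map α).esymm j = (-1) ^ j * c j := by
    intro j
    rcases le_or_gt j D with hj | hj
    · exact hes j hj
    · rw [hcD j hj, Multiset.esymm, Multiset.powersetCard_eq_empty]
      · simp
      · simpa using hj
  have hSp : ∀ n, 1 ≤ n → (S n : ℂ) = -∑ i, α i ^ n := by
    intro n
    induction n using Nat.strong_induction_on with
    | _ n ih =>
      intro hn
      have h1 := newton_identity α n
      have h2 : ((n : ℝ) * c n : ℝ) = ((∑ j ∈ range n, c j * S (n - j) : ℝ) : ℂ) := by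
        rw [hN n hn]
      push_cast at h2
      simp only [hes'] at h1
      have h3 : (n : ℂ) * c n = -∑ j ∈ range n, (c j : ℂ) * ∑ i, α i ^ (n - j) := by
        have h4 : ∀ j, (-1 : ℂ) ^ j * ((-1) ^ j * c j) = c j := by
          intro j
          rw [← mul_assoc, ← mul_pow]; simp
        simp only [h4] at h1
        have h5 := congrArg (fun z => (-1 : ℂ) ^ n * z) h1
        rw [show (-1 : ℂ) ^ n * ((n : ℂ) * ((-1) ^ n * c n)) = n * ((-1) ^ n * ((-1) ^ n * c n)) by
          ring, h4, ← mul_assoc, pow_succ, ← mul_assoc, ← mul_pow] at h5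
        simpa using h5
      rw [h3, ← sum_neg_distrib] at h2
      obtain ⟨n, rfl⟩ : ∃ m, n = m + 1 := ⟨n - 1, by omega⟩
      rw [sum_range_succ', sum_range_succ'] at h2
      rw [sum_congr rfl fun j hj => by
        rw [← mul_neg, ← ih (n + 1 - (j + 1)) (by omega) (by have := mem_range.1 hj; omega)]] at h2
      simp only [hc0, Nat.sub_zero] at h2
      have h6 := add_left_cancel h2
      simpa using h6.symm
  have hbound : ∀ i, ‖α i‖ ≤ ρ := by
    intro i
    by_contra! hlt
    have h1 : ∀ n, 1 ≤ n → n₀ ≤ n → ((‖α i‖ / ρ) ^ 2) ^ n ≤ 2 * (1 + B) := by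
      intro n hn1 hn
      have h2 := norm_le_of_norm_sum_pow_le (fun i => (α i / ρ) ^ (2 * n)) hB (fun j hj _ => by
        have h3 : ∑ i, ((α i / ρ) ^ (2 * n)) ^ j = -(S (2 * (n * j)) : ℂ) / ρ ^ (2 * (n * j)) := by
          rw [hSp _ (by nlinarith), neg_neg, sum_div]
          refine sum_congr rfl fun i _ => ?_
          rw [← pow_mul, div_pow, mul_assoc]
        rw [h3, norm_div, norm_neg, norm_pow, Complex.norm_real, Complex.norm_real,
          Real.norm_eq_abs, Real.norm_eq_abs, abs_of_pos hρ, div_le_iff₀ (by positivity)]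
        exact hS _ (by nlinarith)) i
      simp only [norm_pow, norm_div, Complex.norm_real, Real.norm_eq_abs, abs_of_pos hρ] at h2
      rw [← pow_mul]
      exact h2
    have h4 : 1 < (‖α i‖ / ρ) ^ 2 := one_lt_pow₀ ((one_lt_div hρ).2 hlt) two_ne_zero
    obtain ⟨n, hn⟩ := pow_unbounded_of_one_lt (2 * (1 + B)) h4
    have h5 := h1 (n + n₀ + 1) (by omega) (by omega)
    have h6 : ((‖α i‖ / ρ) ^ 2) ^ n ≤ ((‖α i‖ / ρ) ^ 2) ^ (n + n₀ + 1) :=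
      pow_le_pow_right₀ h4.le (by omega)
    linarith
  have hc1 : (c 1 : ℂ) = -∑ i, α i := by
    have h1 := hN 1 le_rfl
    simp [hc0] at h1
    rw [h1, hSp 1 le_rfl]
    simp
  have h7 : |c 1| = ‖(c 1 : ℂ)‖ := by rw [Complex.norm_real, Real.norm_eq_abs]
  rw [h7, hc1, norm_neg]
  refine (norm_sum_le_of_le _ fun i _ => hbound i).trans ?_
  simp

section AbsTrace

open Finset

variable {K L : Type*} [Field K] [CharP K 2] [Field L] [CharP L 2]

/-- The sum of the first `n` iterated squares of `y`: the absolute trace of `y` if `y` lies in the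
field with `2 ^ n` elements. -/
def absTrace (n : ℕ) (y : K) : K := ∑ i ∈ range n, y ^ 2 ^ i

open Classical in
/-- The additive character `(-1) ^ Tr y` of the field with `2 ^ n` elements. -/
noncomputable def traceSign (n : ℕ) (y : K) : ℤ := if absTrace n y = 0 then 1 else -1

omit [CharP K 2] in
lemma absTrace_zero_right (n : ℕ) : absTrace n (0 : K) = 0 := by
  simp [absTrace]

lemma absTrace_add (n : ℕ) (y z : K) : absTrace n (y + z) = absTrace n y + absTrace n z := by
  simp [absTrace, add_pow_char_pow, sum_add_distrib]

lemma absTrace_sum {ι : Type*} (s : Finset ι) (n : ℕ) (y : ι → K) :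
    absTrace n (∑ i ∈ s, y i) = ∑ i ∈ s, absTrace n (y i) := by
  simp [absTrace, sum_pow_char_pow, sum_comm (s := s)]

omit [CharP K 2] in
lemma absTrace_add_left (m n : ℕ) (y : K) :
    absTrace (m + n) y = absTrace m y + absTrace n (y ^ 2 ^ m) := by
  simp [absTrace, sum_range_add, ← pow_mul, ← pow_add]

lemma absTrace_pow (n j : ℕ) (y : K) : absTrace n (y ^ 2 ^ j) = absTrace n y ^ 2 ^ j := by
  simp [absTrace, sum_pow_char_pow, ← pow_mul, mul_comm]

lemma absTrace_sq (n : ℕ) (y : K) : absTrace n y ^ 2 = absTrace n y + (y ^ 2 ^ n + y) := by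
  have h1 := absTrace_add_left 1 n y
  have h2 := absTrace_add_left n 1 y
  have h3 := absTrace_pow n 1 y
  rw [add_comm 1 n, h2] at h1
  simp only [pow_one] at h1 h3
  have h4 : ∀ z : K, absTrace 1 z = z := fun z => by simp [absTrace]
  rw [h3, h4, h4] at h1
  linear_combination (-1 : K) * h1 - y * CharTwo.two_eq_zero (R := K)

omit [CharP K 2] [CharP L 2] in
lemma map_absTrace (f : K →+* L) (n : ℕ) (y : K) : f (absTrace n y) = absTrace n (f y) := by
  simp [absTrace]

lemma absTrace_eq_zero_or_one {n : ℕ} {y : K} (hy : y ^ 2 ^ n = y) :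
    absTrace n y = 0 ∨ absTrace n y = 1 := by
  have h := absTrace_sq n y
  rw [hy, CharTwo.add_self_eq_zero, add_zero] at h
  have h' : absTrace n y * (absTrace n y - 1) = 0 := by linear_combination h
  exact (mul_eq_zero.1 h').imp_right sub_eq_zero.1

omit [CharP K 2] [CharP L 2] in
lemma traceSign_congr {m n : ℕ} {y : K} {z : L} (h : absTrace m y = 0 ↔ absTrace n z = 0) :
    traceSign m y = traceSign n z := by
  unfold traceSign
  split_ifs <;> tauto

omit [CharP K 2] [CharP L 2] in
lemma traceSign_map (f : K →+* L) (n : ℕ) (y : K) : traceSign n (f y) = traceSign n y :=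
  traceSign_congr (by rw [← map_absTrace, map_eq_zero])

omit [CharP K 2] in
lemma traceSign_zero_right (n : ℕ) : traceSign n (0 : K) = 1 := by
  simp [traceSign, absTrace_zero_right]

lemma traceSign_add {n : ℕ} {y z : K} (hy : y ^ 2 ^ n = y) (hz : z ^ 2 ^ n = z) :
    traceSign n (y + z) = traceSign n y * traceSign n z := by
  have h2 : (1 : K) + 1 = 0 := CharTwo.add_self_eq_zero 1
  rcases absTrace_eq_zero_or_one hy with h | h <;>
    rcases absTrace_eq_zero_or_one hz with h' | h' <;>
    simp [traceSign, absTrace_add, h, h', h2]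

omit [CharP K 2] in
lemma traceSign_eq_one_or (n : ℕ) (y : K) : traceSign n y = 1 ∨ traceSign n y = -1 := by
  unfold traceSign
  split_ifs <;> simp

lemma traceSign_sq_add {n : ℕ} {y : K} (hy : y ^ 2 ^ n = y) : traceSign n (y ^ 2 + y) = 1 := by
  have h := absTrace_pow n 1 y
  rw [pow_one] at h
  simp [traceSign, absTrace_add, h, absTrace_sq, hy, CharTwo.add_self_eq_zero]

lemma exists_traceSign_eq_neg_one [IsAlgClosed K] {n : ℕ} (hn : n ≠ 0) :
    ∃ c : K, c ^ 2 ^ n = c ∧ traceSign n c = -1 := by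
  obtain ⟨k, rfl⟩ := Nat.exists_eq_succ_of_ne_zero hn
  let p : Polynomial K := ∑ i ∈ range (k + 1), Polynomial.X ^ 2 ^ i - Polynomial.C 1
  have hp : p.coeff (2 ^ k) = 1 := by
    simp [p, Polynomial.finsetSum_coeff, Polynomial.coeff_X_pow, Polynomial.coeff_one]
  have hdeg : p.degree ≠ 0 := by
    intro h
    rw [Polynomial.eq_C_of_degree_eq_zero h, Polynomial.coeff_C] at hp
    simp at hp
  obtain ⟨c, hc⟩ := IsAlgClosed.exists_root p hdeg
  have hc1 : absTrace (k + 1) c = 1 := by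
    simpa [p, Polynomial.IsRoot, Polynomial.eval_finsetSum, sub_eq_zero, absTrace] using hc
  refine ⟨c, ?_, by simp [traceSign, hc1]⟩
  have h := absTrace_sq (k + 1) c
  rw [hc1] at h
  have : c ^ 2 ^ (k + 1) + c = 0 := by linear_combination -h
  exact CharTwo.add_eq_zero.1 this

end AbsTrace

section Orbits

open Finset Polynomial Function

variable {K : Type*} [Field K] (φ : K →+* K)

/-- The product of the linear factors along the first `k` points of the orbit of `x`. -/
noncomputable def orbitPoly (k : ℕ) (x : K) : K[X] := ∏ i ∈ range k, (X - C (φ^[i] x))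

lemma orbitPoly_monic (k : ℕ) (x : K) : (orbitPoly φ k x).Monic :=
  monic_prod_of_monic _ _ fun _ _ => monic_X_sub_C _

lemma natDegree_orbitPoly (k : ℕ) (x : K) : (orbitPoly φ k x).natDegree = k := by
  rw [orbitPoly, natDegree_prod_of_monic _ _ fun _ _ => monic_X_sub_C _]
  simp

lemma iterate_ringHom_ne_zero {x : K} (hx : x ≠ 0) (i : ℕ) : φ^[i] x ≠ 0 := by
  rw [← RingHom.coe_pow]
  exact (_root_.map_ne_zero _).2 hx

lemma coeff_zero_orbitPoly_ne_zero (k : ℕ) {x : K} (hx : x ≠ 0) :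
    (orbitPoly φ k x).coeff 0 ≠ 0 := by
  rw [coeff_zero_eq_eval_zero, orbitPoly, eval_prod, prod_ne_zero_iff]
  intro i _
  simpa using iterate_ringHom_ne_zero φ hx i

lemma map_orbitPoly {k : ℕ} {x : K} (hx : φ^[k] x = x) :
    (orbitPoly φ k x).map φ = orbitPoly φ k x := by
  rcases k with _ | k
  · simp [orbitPoly]
  · rw [orbitPoly, Polynomial.map_prod, prod_range_succ, prod_range_succ']
    simp only [Polynomial.map_sub, map_X, map_C, ← iterate_succ_apply' φ]
    rw [Nat.succ_eq_add_one, hx]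
    rfl

lemma orbitPoly_mul {δ : ℕ} {x : K} (hx : φ^[δ] x = x) (e : ℕ) :
    orbitPoly φ (δ * e) x = orbitPoly φ δ x ^ e := by
  induction e with
  | zero => simp [orbitPoly]
  | succ e ih =>
    rw [pow_succ, ← ih, Nat.mul_succ, orbitPoly, prod_range_add, orbitPoly, orbitPoly]
    have h1 : φ^[δ * e] x = x := IsPeriodicPt.mul_const (f := φ) (n := e) hx
    congr 1
    refine prod_congr rfl fun i _ => ?_
    rw [add_comm, iterate_add_apply, h1]

lemma rootMultiplicity_iterate {g : K[X]} (hg : g.map φ = g) (x : K) (i : ℕ) :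
    g.rootMultiplicity (φ^[i] x) = g.rootMultiplicity x := by
  induction i with
  | zero => rfl
  | succ i ih =>
    rw [iterate_succ_apply', ← ih]
    conv_lhs => rw [← hg]
    exact (eq_rootMultiplicity_map φ.injective _).symm

lemma orbitPoly_pow_dvd_iff {g : K[X]} (hg0 : g ≠ 0) (hg : g.map φ = g) {x : K}
    (hx : 0 < minimalPeriod φ x) (e : ℕ) :
    orbitPoly φ (minimalPeriod φ x) x ^ e ∣ g ↔ e ≤ g.rootMultiplicity x := by
  rw [le_rootMultiplicity_iff hg0]
  constructor
  · intro h
    refine (pow_dvd_pow_of_dvd ?_ e).trans h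
    have h1 := dvd_prod_of_mem (fun i => X - C (φ^[i] x)) (mem_range.2 hx)
    rwa [iterate_zero, id] at h1
  · intro h
    rw [orbitPoly, ← prod_pow]
    refine Finset.prod_dvd_of_coprime (fun i hi j hj hij => ?_) fun i _ => ?_
    · refine IsCoprime.pow (pairwise_coprime_X_sub_C (s := id) injective_id ?_)
      intro h'
      exact hij (iterate_injOn_Iio_minimalPeriod (mem_range.1 hi) (mem_range.1 hj) h')
    · rw [← le_rootMultiplicity_iff hg0] at h ⊢
      rwa [rootMultiplicity_iterate φ hg]

lemma minimalPeriod_pos_of_isRoot {g : K[X]} (hg0 : g ≠ 0) (hg : g.map φ = g) {x : K}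
    (hx : g.IsRoot x) : 0 < minimalPeriod φ x := by
  have hroot : ∀ i, φ^[i] x ∈ g.rootSet K := by
    intro i
    have h1 : 0 < g.rootMultiplicity (φ^[i] x) := by
      rw [rootMultiplicity_iterate φ hg]
      exact (rootMultiplicity_pos hg0).2 hx
    rw [mem_rootSet]
    simpa [hg0] using (rootMultiplicity_pos hg0).1 h1
  obtain ⟨i, j, hij, h⟩ := Finite.exists_ne_map_eq_of_infinite
    (fun i => (⟨φ^[i] x, hroot i⟩ : g.rootSet K))
  have h' : φ^[i] x = φ^[j] x := congrArg Subtype.val h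
  wlog hlt : i < j generalizing i j
  · exact this j i hij.symm h.symm h'.symm (by omega)
  refine IsPeriodicPt.minimalPeriod_pos (n := j - i) (by omega) ?_
  refine (φ.injective.iterate i) ?_
  rw [← iterate_add_apply, h', Nat.add_sub_cancel' hlt.le]

open Classical in
lemma card_filter_orbitPoly_dvd {g : K[X]} (hg0 : g ≠ 0) (hg : g.map φ = g) {x : K}
    (hx : g.IsRoot x) :
    #{k ∈ Icc 1 g.natDegree | φ^[k] x = x ∧ orbitPoly φ k x ∣ g} = g.rootMultiplicity x := by
  have hδ := minimalPeriod_pos_of_isRoot φ hg0 hg hx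
  have hper : φ^[minimalPeriod φ x] x = x := iterate_minimalPeriod
  have hcard : #(Icc 1 (g.rootMultiplicity x)) = g.rootMultiplicity x := by simp
  rw [← hcard]
  symm
  refine card_nbij (fun e => minimalPeriod φ x * e) ?_ ?_ ?_
  · intro e he
    rw [mem_coe, mem_Icc] at he
    have hdvd : orbitPoly φ (minimalPeriod φ x * e) x ∣ g := by
      rw [orbitPoly_mul φ hper]
      exact (orbitPoly_pow_dvd_iff φ hg0 hg hδ e).2 he.2
    have hle := natDegree_le_of_dvd hdvd hg0
    rw [natDegree_orbitPoly] at hle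
    rw [mem_coe, mem_filter, mem_Icc]
    exact ⟨⟨Nat.mul_pos hδ he.1, hle⟩, IsPeriodicPt.mul_const (f := φ) (n := e) hper, hdvd⟩
  · intro e _ e' _ h
    exact Nat.eq_of_mul_eq_mul_left hδ h
  · intro k hk
    rw [mem_coe, mem_filter, mem_Icc] at hk
    obtain ⟨⟨hk1, -⟩, hkx, hdvd⟩ := hk
    obtain ⟨e, rfl⟩ := IsPeriodicPt.minimalPeriod_dvd (f := φ) hkx
    rw [orbitPoly_mul φ hper, orbitPoly_pow_dvd_iff φ hg0 hg hδ] at hdvd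
    refine ⟨e, mem_coe.2 (mem_Icc.2 ⟨?_, hdvd⟩), rfl⟩
    exact Nat.pos_of_mul_pos_left hk1

/-- The monic polynomials of degree `d` with nonzero constant coefficient fixed by `φ`. -/
def fixedMonic (d : ℕ) : Set K[X] :=
  {g | g.Monic ∧ g.natDegree = d ∧ g.coeff 0 ≠ 0 ∧ g.map φ = g}

lemma fixedMonic_finite (hφ : {x | φ x = x}.Finite) (d : ℕ) : (fixedMonic φ d).Finite := by
  have hfin : {f : Fin (d + 1) → K | ∀ i, f i ∈ {x | φ x = x}}.Finite := Set.Finite.pi' fun _ => hφ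
  refine Set.Finite.of_injOn (f := fun (g : K[X]) (i : Fin (d + 1)) => g.coeff i) ?_ ?_ hfin
  · rintro g ⟨-, -, -, hg⟩ i
    show φ (g.coeff i) = g.coeff i
    rw [← coeff_map, hg]
  · rintro g ⟨-, hg, -, -⟩ g' ⟨-, hg', -, -⟩ h
    ext n
    by_cases hn : n < d + 1
    · exact congrFun h ⟨n, hn⟩
    · rw [coeff_eq_zero_of_natDegree_lt (by omega), coeff_eq_zero_of_natDegree_lt (by omega)]

lemma orbitPoly_mem_fixedMonic {k : ℕ} {x : K} (hx : x ≠ 0) (hk : φ^[k] x = x) :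
    orbitPoly φ k x ∈ fixedMonic φ k :=
  ⟨orbitPoly_monic φ k x, natDegree_orbitPoly φ k x, coeff_zero_orbitPoly_ne_zero φ k hx,
    map_orbitPoly φ hk⟩

lemma mul_mem_fixedMonic {i j : ℕ} {g h : K[X]} (hg : g ∈ fixedMonic φ i)
    (hh : h ∈ fixedMonic φ j) : g * h ∈ fixedMonic φ (i + j) := by
  obtain ⟨hg1, hg2, hg3, hg4⟩ := hg
  obtain ⟨hh1, hh2, hh3, hh4⟩ := hh
  refine ⟨hg1.mul hh1, ?_, ?_, ?_⟩
  · rw [hg1.natDegree_mul hh1, hg2, hh2]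
  · rw [mul_coeff_zero]
    exact mul_ne_zero hg3 hh3
  · rw [Polynomial.map_mul, hg4, hh4]

lemma mem_fixedMonic_of_mul {i j : ℕ} {g h : K[X]} (hg : g ∈ fixedMonic φ i)
    (hgh : g * h ∈ fixedMonic φ (i + j)) : h ∈ fixedMonic φ j := by
  obtain ⟨hg1, hg2, hg3, hg4⟩ := hg
  obtain ⟨h1, h2, h3, h4⟩ := hgh
  have hh1 : h.Monic := hg1.of_mul_monic_left h1
  refine ⟨hh1, ?_, ?_, ?_⟩
  · rw [hg1.natDegree_mul hh1, hg2] at h2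
    omega
  · rw [mul_coeff_zero] at h3
    exact right_ne_zero_of_mul h3
  · rw [Polynomial.map_mul, hg4] at h4
    exact mul_left_cancel₀ hg1.ne_zero h4

open Classical in
lemma sum_fixedMonic_dvd (M : ℕ → Finset K[X]) (hM : ∀ d g, g ∈ M d ↔ g ∈ fixedMonic φ d)
    (Λ : K[X] → ℤ) (hΛ : ∀ i j, ∀ g ∈ fixedMonic φ i, ∀ h ∈ fixedMonic φ j, Λ (g * h) = Λ g * Λ h)
    {k d : ℕ} (hkd : k ≤ d) {h : K[X]} (hh : h ∈ fixedMonic φ k) :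
    ∑ g ∈ M d with h ∣ g, Λ g = Λ h * ∑ g ∈ M (d - k), Λ g := by
  rw [mul_sum]
  symm
  refine sum_bij (fun g _ => h * g) ?_ ?_ ?_ ?_
  · intro g hg
    rw [hM] at hg
    rw [mem_filter, hM]
    refine ⟨?_, dvd_mul_right _ _⟩
    have := mul_mem_fixedMonic φ hh hg
    rwa [Nat.add_sub_cancel' hkd] at this
  · intro g _ g' _ h'
    exact mul_left_cancel₀ hh.1.ne_zero h'
  · intro g hg
    rw [mem_filter, hM] at hg
    obtain ⟨hg, g', rfl⟩ := hg
    refine ⟨g', ?_, rfl⟩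
    rw [hM]
    refine mem_fixedMonic_of_mul φ hh ?_
    rwa [Nat.add_sub_cancel' hkd]
  · intro g hg
    rw [hM] at hg
    exact (hΛ _ _ _ hh _ hg).symm

open Classical in
lemma natDegree_eq_sum_orbitPoly_dvd [IsAlgClosed K] (P : ℕ → Finset K)
    (hP : ∀ k, 1 ≤ k → ∀ x, x ∈ P k ↔ x ≠ 0 ∧ φ^[k] x = x)
    {d : ℕ} {g : K[X]} (hg : g ∈ fixedMonic φ d) :
    d = ∑ k ∈ Icc 1 d, #{x ∈ P k | orbitPoly φ k x ∣ g} := by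
  obtain ⟨hg1, hg2, hg3, hg4⟩ := hg
  have hg0 := hg1.ne_zero
  have h1 : ∀ k ∈ Icc 1 d, {x ∈ P k | orbitPoly φ k x ∣ g} =
      {x ∈ g.roots.toFinset | φ^[k] x = x ∧ orbitPoly φ k x ∣ g} := by
    intro k hk
    have hk1 := (mem_Icc.1 hk).1
    ext x
    rw [mem_filter, mem_filter, hP k hk1, Multiset.mem_toFinset, mem_roots hg0]
    constructor
    · rintro ⟨⟨-, h2⟩, h3⟩
      refine ⟨?_, h2, h3⟩
      refine dvd_iff_isRoot.1 (Dvd.dvd.trans ?_ h3)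
      have h4 := dvd_prod_of_mem (fun i => X - C (φ^[i] x)) (mem_range.2 hk1)
      rwa [iterate_zero, id] at h4
    · rintro ⟨h2, h3, h4⟩
      refine ⟨⟨?_, h3⟩, h4⟩
      rintro rfl
      exact hg3 (by rwa [coeff_zero_eq_eval_zero])
  rw [sum_congr rfl fun k hk => congrArg card (h1 k hk)]
  simp_rw [card_filter]
  rw [sum_comm]
  simp_rw [← card_filter]
  have h2 : ∀ x ∈ g.roots.toFinset,
      #{k ∈ Icc 1 d | φ^[k] x = x ∧ orbitPoly φ k x ∣ g} = g.roots.count x := by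
    intro x hx
    rw [Multiset.mem_toFinset, mem_roots hg0] at hx
    rw [← hg2, card_filter_orbitPoly_dvd φ hg0 hg4 hx, count_roots]
  rw [sum_congr rfl h2, Multiset.toFinset_sum_count_eq, ← hg2]
  exact (splits_iff_card_roots.1 (IsAlgClosed.splits g)).symm

/-- Newton's identity for the `L`-function of a completely multiplicative `Λ`. -/
theorem newton_fixedMonic [IsAlgClosed K] (M : ℕ → Finset K[X])
    (hM : ∀ d g, g ∈ M d ↔ g ∈ fixedMonic φ d) (P : ℕ → Finset K)
    (hP : ∀ k, 1 ≤ k → ∀ x, x ∈ P k ↔ x ≠ 0 ∧ φ^[k] x = x)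
    (Λ : K[X] → ℤ) (hΛ : ∀ i j, ∀ g ∈ fixedMonic φ i, ∀ h ∈ fixedMonic φ j, Λ (g * h) = Λ g * Λ h)
    (d : ℕ) : d * ∑ g ∈ M d, Λ g =
      ∑ j ∈ range d, (∑ g ∈ M j, Λ g) * ∑ x ∈ P (d - j), Λ (orbitPoly φ (d - j) x) := by
  classical
  have h1 : d * ∑ g ∈ M d, Λ g =
      ∑ k ∈ Icc 1 d, (∑ g ∈ M (d - k), Λ g) * ∑ x ∈ P k, Λ (orbitPoly φ k x) := by
    calc d * ∑ g ∈ M d, Λ g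
        = ∑ g ∈ M d, ∑ k ∈ Icc 1 d, ∑ x ∈ P k, if orbitPoly φ k x ∣ g then Λ g else 0 := by
          rw [mul_sum]
          refine sum_congr rfl fun g hg => ?_
          rw [hM] at hg
          conv_lhs => rw [natDegree_eq_sum_orbitPoly_dvd φ P hP hg]
          push_cast
          rw [sum_mul]
          refine sum_congr rfl fun k _ => ?_
          rw [← sum_filter, sum_const, nsmul_eq_mul]
      _ = ∑ k ∈ Icc 1 d, ∑ x ∈ P k, ∑ g ∈ M d with orbitPoly φ k x ∣ g, Λ g := by
          rw [sum_comm]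
          refine sum_congr rfl fun k _ => ?_
          rw [sum_comm]
          simp_rw [sum_filter]
      _ = _ := by
          refine sum_congr rfl fun k hk => ?_
          rw [mem_Icc] at hk
          rw [mul_comm, sum_mul]
          refine sum_congr rfl fun x hx => ?_
          rw [hP k hk.1] at hx
          exact sum_fixedMonic_dvd φ M hM Λ hΛ hk.2 (orbitPoly_mem_fixedMonic φ hx.1 hx.2)
  rw [h1]
  refine sum_nbij' (fun k => d - k) (fun j => d - j) ?_ ?_ ?_ ?_ ?_
  · intro k hk
    rw [mem_Icc] at hk
    rw [mem_range]
    omega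
  · intro j hj
    rw [mem_range] at hj
    rw [mem_Icc]
    omega
  · intro k hk
    rw [mem_Icc] at hk
    exact Nat.sub_sub_self hk.2
  · intro j hj
    rw [mem_range] at hj
    exact Nat.sub_sub_self hj.le
  · intro k hk
    rw [mem_Icc] at hk
    rw [Nat.sub_sub_self hk.2]

end Orbits

section LFunction

open Finset Polynomial Function

section FixedPoints

variable (K : Type*) [Field K] [CharP K 2]

open Classical in
/-- The elements of `K` fixed by the `N`-th power of the Frobenius, for `N ≠ 0`. -/
noncomputable def frobFixed (N : ℕ) : Finset K := (X ^ 2 ^ N - X : K[X]).roots.toFinset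

variable {K}

omit [CharP K 2] in
lemma X_pow_two_pow_sub_X_ne_zero {N : ℕ} (hN : N ≠ 0) : (X ^ 2 ^ N - X : K[X]) ≠ 0 :=
  FiniteField.X_pow_card_sub_X_ne_zero K (Nat.one_lt_two_pow hN)

omit [CharP K 2] in
lemma mem_frobFixed {N : ℕ} (hN : N ≠ 0) {x : K} : x ∈ frobFixed K N ↔ x ^ 2 ^ N = x := by
  classical
  rw [frobFixed, Multiset.mem_toFinset, mem_roots (X_pow_two_pow_sub_X_ne_zero hN)]
  simp [sub_eq_zero]

lemma card_frobFixed [IsAlgClosed K] {N : ℕ} (hN : N ≠ 0) : #(frobFixed K N) = 2 ^ N := by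
  classical
  have hsep : (X ^ 2 ^ N - X : K[X]).Separable :=
    galois_poly_separable 2 _ (dvd_pow_self 2 hN)
  rw [frobFixed, Multiset.toFinset_card_of_nodup (nodup_roots hsep),
    splits_iff_card_roots.1 (IsAlgClosed.splits _),
    FiniteField.X_pow_card_sub_X_natDegree_eq K (Nat.one_lt_two_pow hN)]

lemma iterate_iterateFrobenius (m k : ℕ) (x : K) :
    (iterateFrobenius K 2 m)^[k] x = x ^ 2 ^ (m * k) := by
  induction k with
  | zero => simp
  | succ k ih =>
    rw [iterate_succ_apply', ih, iterateFrobenius_def, ← pow_mul, ← pow_add, Nat.mul_succ]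

end FixedPoints

variable {K : Type*} [Field K]

/-- The rational function `α x ^ 3 + β x + γ / x`. -/
def laurentCubic (α β γ x : K) : K := α * x ^ 3 + β * x + γ * x⁻¹

/-- The sum of `laurentCubic α β γ` over the roots of a monic polynomial in characteristic two, in
terms of the coefficients of the polynomial. -/
noncomputable def rootSum (α β γ : K) (g : K[X]) : K :=
  α * (g.reverse.coeff 1 ^ 3 + g.reverse.coeff 1 * g.reverse.coeff 2 + g.reverse.coeff 3) +
    β * g.reverse.coeff 1 + γ * (g.coeff 1 / g.coeff 0)

variable (α β γ : K)

lemma map_laurentCubic {L : Type*} [Field L] (φ : K →+* L) (x : K) :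
    φ (laurentCubic α β γ x) = laurentCubic (φ α) (φ β) (φ γ) (φ x) := by
  simp [laurentCubic]

lemma rootSum_one : rootSum α β γ 1 = 0 := by
  have h : (1 : K[X]).reverse = 1 := by rw [← C_1, reverse_C]
  simp [rootSum, h, coeff_one]

lemma map_rootSum (φ : K →+* K) (hα : φ α = α) (hβ : φ β = β) (hγ : φ γ = γ) {g : K[X]}
    (hg : g.map φ = g) : φ (rootSum α β γ g) = rootSum α β γ g := by
  have h : ∀ i, φ (g.coeff i) = g.coeff i := fun i => by rw [← coeff_map, hg]
  simp [rootSum, coeff_reverse, h, hα, hβ, hγ]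

section CharTwo

variable [CharP K 2]

lemma rootSum_mul {g h : K[X]} (hg : g.Monic) (hh : h.Monic) (hg0 : g.coeff 0 ≠ 0)
    (hh0 : h.coeff 0 ≠ 0) : rootSum α β γ (g * h) = rootSum α β γ g + rootSum α β γ h := by
  have h2 : (2 : K) = 0 := CharTwo.two_eq_zero
  have e0 : g.reverse.coeff 0 = 1 := by rw [coeff_zero_reverse, hg.leadingCoeff]
  have f0 : h.reverse.coeff 0 = 1 := by rw [coeff_zero_reverse, hh.leadingCoeff]
  have h1 : (g * h).coeff 1 / (g * h).coeff 0 = g.coeff 1 / g.coeff 0 + h.coeff 1 / h.coeff 0 := by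
    rw [mul_coeff_zero, mul_coeff_one]
    field_simp
    ring
  rw [rootSum, h1, reverse_mul_of_domain, rootSum, rootSum]
  simp only [coeff_mul, Finset.Nat.sum_antidiagonal_eq_sum_range_succ_mk, sum_range_succ,
    sum_range_zero, zero_add, Nat.reduceSub, e0, f0, one_mul, mul_one, tsub_zero,
    tsub_self]
  generalize g.reverse.coeff 1 = r1
  generalize g.reverse.coeff 2 = r2
  generalize g.reverse.coeff 3 = r3
  generalize h.reverse.coeff 1 = s1
  generalize h.reverse.coeff 2 = s2
  generalize h.reverse.coeff 3 = s3
  linear_combination (α * (2 * r1 ^ 2 * s1 + 2 * r1 * s1 ^ 2 + r1 * s2 + s1 * r2)) * h2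

lemma rootSum_X_sub_C (x : K) : rootSum α β γ (X - C x) = laurentCubic α β γ x := by
  have h1 : (X - C x).reverse.coeff 1 = x := by
    rw [coeff_reverse]
    simp [revAt, CharTwo.neg_eq]
  have h2 : (X - C x).reverse.coeff 2 = 0 := by
    rw [coeff_reverse]
    simp [revAt, coeff_X]
  have h3 : (X - C x).reverse.coeff 3 = 0 := by
    rw [coeff_reverse]
    simp [revAt, coeff_X]
  rw [rootSum, h1, h2, h3, laurentCubic]
  simp [coeff_C, CharTwo.neg_eq]

lemma rootSum_orbitPoly (φ : K →+* K) (k : ℕ) {x : K} (hx : x ≠ 0) :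
    rootSum α β γ (orbitPoly φ k x) = ∑ i ∈ range k, laurentCubic α β γ (φ^[i] x) := by
  induction k with
  | zero => simp [orbitPoly, rootSum_one]
  | succ k ih =>
    have h1 : orbitPoly φ (k + 1) x = orbitPoly φ k x * (X - C (φ^[k] x)) := prod_range_succ _ _
    rw [h1, rootSum_mul α β γ (orbitPoly_monic φ k x) (monic_X_sub_C _)
      (coeff_zero_orbitPoly_ne_zero φ k hx), ih, sum_range_succ, rootSum_X_sub_C]
    simpa using iterate_ringHom_ne_zero φ hx k

variable {α β γ} {m : ℕ} (hα : α ^ 2 ^ m = α) (hβ : β ^ 2 ^ m = β) (hγ : γ ^ 2 ^ m = γ)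
include hα hβ hγ

lemma laurentCubic_pow (k : ℕ) (x : K) :
    laurentCubic α β γ x ^ 2 ^ (m * k) = laurentCubic α β γ (x ^ 2 ^ (m * k)) := by
  induction k with
  | zero => simp
  | succ k ih =>
    rw [Nat.mul_succ, pow_add, pow_mul, pow_mul x, ih, ← iterateFrobenius_def,
      ← iterateFrobenius_def, map_laurentCubic]
    simp only [iterateFrobenius_def, hα, hβ, hγ]

lemma traceSign_rootSum_orbitPoly (k : ℕ) {x : K} (hx : x ≠ 0) :
    traceSign m (rootSum α β γ (orbitPoly (iterateFrobenius K 2 m) k x)) =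
      traceSign (m * k) (laurentCubic α β γ x) := by
  refine traceSign_congr (Eq.congr_left ?_)
  rw [rootSum_orbitPoly α β γ _ k hx, absTrace_sum]
  induction k with
  | zero => simp [absTrace]
  | succ k ih =>
    rw [sum_range_succ, ih, Nat.mul_succ, absTrace_add_left, laurentCubic_pow hα hβ hγ,
      iterate_iterateFrobenius]

lemma rootSum_pow {g : K[X]} (hg : g.map (iterateFrobenius K 2 m) = g) :
    rootSum α β γ g ^ 2 ^ m = rootSum α β γ g := by
  have := map_rootSum α β γ (iterateFrobenius K 2 m) hα hβ hγ hg
  rwa [iterateFrobenius_def] at this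

end CharTwo

end LFunction

section Stepanov

open Finset Polynomial

variable {K : Type*} [Field K] {α β γ : K}

/-- `X ^ h` times the trace `∑ i, f ^ 2 ^ i` of length `r + 1` of the rational function
`f = laurentCubic α β γ`, where `h = 2 ^ r`. -/
noncomputable def tracePoly (α β γ : K) (r : ℕ) : K[X] :=
  ∑ i ∈ range (r + 1), (C (α ^ 2 ^ i) * X ^ (3 * 2 ^ i + 2 ^ r) +
    C (β ^ 2 ^ i) * X ^ (2 ^ i + 2 ^ r) +
    C (γ ^ 2 ^ i) * X ^ (2 ^ r - 2 ^ i))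

lemma eval_tracePoly [CharP K 2] (r : ℕ) {x : K} (hx : x ≠ 0) :
    (tracePoly α β γ r).eval x = x ^ 2 ^ r * absTrace (r + 1) (laurentCubic α β γ x) := by
  rw [tracePoly, eval_finsetSum, absTrace, mul_sum]
  refine sum_congr rfl fun i hi => ?_
  have hle : 2 ^ i ≤ 2 ^ r := Nat.pow_le_pow_right two_pos (Nat.lt_succ_iff.1 (mem_range.1 hi))
  have h1 : x ^ 2 ^ r = x ^ (2 ^ r - 2 ^ i) * x ^ 2 ^ i := by
    rw [← pow_add, Nat.sub_add_cancel hle]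
  have h2 : (x⁻¹) ^ 2 ^ i * x ^ 2 ^ i = 1 := by
    rw [← mul_pow, inv_mul_cancel₀ hx, one_pow]
  rw [laurentCubic, add_pow_char_pow, add_pow_char_pow, mul_pow, mul_pow, mul_pow]
  simp only [eval_add, eval_mul, eval_C, eval_pow, eval_X]
  rw [pow_add, pow_add, pow_mul, pow_right_comm]
  linear_combination (-(γ ^ 2 ^ i) * x⁻¹ ^ 2 ^ i) * h1 - (γ ^ 2 ^ i * x ^ (2 ^ r - 2 ^ i)) * h2

lemma natDegree_tracePoly_of_ne_zero (hα : α ≠ 0) (r : ℕ) :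
    (tracePoly α β γ r).natDegree = 2 * (2 * 2 ^ r) := by
  have hr := Nat.two_pow_pos r
  have h1 : ∀ i < r, 2 * 2 ^ i ≤ 2 ^ r := fun i hi => by
    rw [← pow_succ']; exact Nat.pow_le_pow_right two_pos hi
  have hle : ∀ i ≤ r, 2 ^ i ≤ 2 ^ r := fun i hi => Nat.pow_le_pow_right two_pos hi
  refine natDegree_eq_of_le_of_coeff_ne_zero ?_ ?_
  · refine natDegree_sum_le_of_forall_le _ _ fun i hi => ?_
    have := hle i (Nat.lt_succ_iff.1 (mem_range.1 hi))
    have := Nat.two_pow_pos i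
    refine natDegree_add_le_of_degree_le (natDegree_add_le_of_degree_le ?_ ?_) ?_ <;>
      exact (natDegree_C_mul_X_pow_le _ _).trans (by omega)
  · rw [tracePoly, finsetSum_coeff, sum_range_succ, sum_eq_zero fun i hi => ?_]
    · simp only [coeff_add, coeff_C_mul_X_pow]
      rw [if_pos (by omega), if_neg (by omega), if_neg (by omega)]
      simpa using hα
    · have := h1 i (mem_range.1 hi)
      have := Nat.two_pow_pos i
      simp only [coeff_add, coeff_C_mul_X_pow]
      rw [if_neg (by omega), if_neg (by omega), if_neg (by omega)]
      simp

lemma natDegree_tracePoly_of_eq_zero (hβ : β ≠ 0) (r : ℕ) :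
    (tracePoly 0 β γ r).natDegree = 1 * (2 * 2 ^ r) := by
  have hr := Nat.two_pow_pos r
  have h1 : ∀ i < r, 2 * 2 ^ i ≤ 2 ^ r := fun i hi => by
    rw [← pow_succ']; exact Nat.pow_le_pow_right two_pos hi
  have hle : ∀ i ≤ r, 2 ^ i ≤ 2 ^ r := fun i hi => Nat.pow_le_pow_right two_pos hi
  have h0 : ∀ i, (0 : K) ^ 2 ^ i = 0 := fun i => zero_pow (Nat.two_pow_pos i).ne'
  simp only [tracePoly, h0, C_0, zero_mul, zero_add]
  refine natDegree_eq_of_le_of_coeff_ne_zero ?_ ?_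
  · refine natDegree_sum_le_of_forall_le _ _ fun i hi => ?_
    have := hle i (Nat.lt_succ_iff.1 (mem_range.1 hi))
    have := Nat.two_pow_pos i
    refine natDegree_add_le_of_degree_le ?_ ?_ <;>
      exact (natDegree_C_mul_X_pow_le _ _).trans (by omega)
  · rw [finsetSum_coeff, sum_range_succ, sum_eq_zero fun i hi => ?_]
    · simp only [coeff_add, coeff_C_mul_X_pow]
      rw [if_pos (by omega), if_neg (by omega)]
      simpa using hβ
    · have := h1 i (mem_range.1 hi)
      have := Nat.two_pow_pos i
      simp only [coeff_add, coeff_C_mul_X_pow]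
      rw [if_neg (by omega), if_neg (by omega)]
      simp

/-- Stepanov's bound for the exponential sum of a Laurent polynomial over the field with
`2 ^ (2 * (r + 1))` elements. -/
lemma abs_sum_traceSign_laurentCubic_le [IsAlgClosed K] [CharP K 2] (hαβ : α ≠ 0 ∨ β ≠ 0) {r : ℕ}
    (hr : 2 ≤ r) (P : Finset K) (hP : ∀ x, x ∈ P ↔ x ≠ 0 ∧ x ^ 2 ^ (2 * (r + 1)) = x)
    (hα : α ^ 2 ^ (2 * (r + 1)) = α) (hβ : β ^ 2 ^ (2 * (r + 1)) = β)
    (hγ : γ ^ 2 ^ (2 * (r + 1)) = γ) :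
    |∑ x ∈ P, traceSign (2 * (r + 1)) (laurentCubic α β γ x)| ≤ 8 * 2 ^ (r + 1) := by
  classical
  set h := 2 ^ r with hh
  have h4 : 4 ≤ h := (Nat.pow_le_pow_right two_pos hr : 2 ^ 2 ≤ 2 ^ r)
  have hR : 2 ^ (r + 1) = 2 * h := pow_succ' 2 r
  have hQ : 2 ^ (2 * (r + 1)) = (2 * h) ^ 2 := by rw [mul_comm, pow_mul, hR]
  obtain ⟨e, he, hdeg⟩ : ∃ e, (e = 1 ∨ e = 2) ∧ (tracePoly α β γ r).natDegree = e * (2 * h) := by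
    by_cases h0 : α = 0
    · subst h0
      exact ⟨1, Or.inl rfl, natDegree_tracePoly_of_eq_zero (hαβ.resolve_left (not_not.2 rfl)) r⟩
    · exact ⟨2, Or.inr rfl, natDegree_tracePoly_of_ne_zero h0 r⟩
  have hT0 : tracePoly α β γ r ≠ 0 := by
    intro h0
    rw [h0, natDegree_zero] at hdeg
    rcases he with rfl | rfl <;> omega
  have hfix : ∀ x ∈ P, laurentCubic α β γ x ^ 2 ^ (2 * (r + 1)) = laurentCubic α β γ x := by
    intro x hx
    have := laurentCubic_pow hα hβ hγ 1 x
    rwa [mul_one, ((hP x).1 hx).2] at this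
  have hcard : ∀ ε : K,
      #{x ∈ P | absTrace (2 * (r + 1)) (laurentCubic α β γ x) = ε} ≤ 2 * h ^ 2 + 7 * h := by
    intro ε
    refine stepanov_card_le (r + 1) h e hR h4 _ hT0 hdeg (by omega) ε _ fun x hx => ?_
    obtain ⟨hxP, hε⟩ := mem_filter.1 hx
    obtain ⟨hx0, hxQ⟩ := (hP x).1 hxP
    rw [hQ] at hxQ
    refine ⟨hx0, hxQ, _, eval_tracePoly r hx0, ?_⟩
    rw [two_mul, absTrace_add_left, absTrace_pow, hR] at hε
    rw [← hε, ← add_assoc, CharTwo.add_self_eq_zero, zero_add]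
  have hcardP : #P = 2 ^ (2 * (r + 1)) - 1 := by
    rw [← card_frobFixed (K := K) (N := 2 * (r + 1)) (by omega),
      ← card_erase_of_mem (a := 0) ((mem_frobFixed (by omega)).2 (by simp))]
    congr 1
    ext x
    rw [hP, mem_erase, mem_frobFixed (by omega)]
  have h0 := hcard 0
  have h1 := hcard 1
  have hsum : #{x ∈ P | absTrace (2 * (r + 1)) (laurentCubic α β γ x) = 0} +
      #{x ∈ P | absTrace (2 * (r + 1)) (laurentCubic α β γ x) = 1} = #P := by
    rw [← card_filter_add_card_filter_not (s := P)
      (p := fun x => absTrace (2 * (r + 1)) (laurentCubic α β γ x) = 0)]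
    congr 2
    refine filter_congr fun x hx => ?_
    rcases absTrace_eq_zero_or_one (hfix x hx) with h' | h' <;> simp [h']
  have hval : ∑ x ∈ P, traceSign (2 * (r + 1)) (laurentCubic α β γ x) =
      2 * (#{x ∈ P | absTrace (2 * (r + 1)) (laurentCubic α β γ x) = 0} : ℤ) - #P := by
    have h2 : ∀ x ∈ P, traceSign (2 * (r + 1)) (laurentCubic α β γ x) =
        2 * (if absTrace (2 * (r + 1)) (laurentCubic α β γ x) = 0 then 1 else 0) - 1 := by
      intro x _
      unfold traceSign
      split_ifs <;> norm_num
    rw [sum_congr rfl h2, sum_sub_distrib, ← mul_sum, sum_boole]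
    simp
  have hQ' : (2 * h) ^ 2 = 2 * h ^ 2 + 2 * h ^ 2 := by ring
  have hpos : 0 < h ^ 2 := by positivity
  rw [hcardP, hQ, hQ'] at hsum
  have hR' : (2 : ℤ) ^ (r + 1) = 2 * h := by exact_mod_cast hR
  rw [hval, hR', hcardP, hQ, hQ', abs_le]
  generalize #{x ∈ P | absTrace (2 * (r + 1)) (laurentCubic α β γ x) = 0} = a at *
  generalize #{x ∈ P | absTrace (2 * (r + 1)) (laurentCubic α β γ x) = 1} = b at *
  generalize h ^ 2 = w at *
  omega

end Stepanov

section WeilBound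

open Finset Polynomial

variable {K : Type*} [Field K] [CharP K 2] {α β γ : K} {m : ℕ}

lemma add_C_mul_X_pow_mem_fixedMonic {d j : ℕ} {g : K[X]} {c : K}
    (hg : g ∈ fixedMonic (iterateFrobenius K 2 m) d) (hc : c ^ 2 ^ m = c) (hj : 1 ≤ j)
    (hjd : j < d) : g + C c * X ^ j ∈ fixedMonic (iterateFrobenius K 2 m) d := by
  obtain ⟨h1, h2, h3, h4⟩ := hg
  have hlt : (C c * X ^ j).degree < g.degree := by
    rw [degree_eq_natDegree h1.ne_zero, h2]
    exact (degree_C_mul_X_pow_le _ _).trans_lt (by exact_mod_cast hjd)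
  refine ⟨h1.add_of_left hlt, ?_, ?_, ?_⟩
  · rw [natDegree_add_eq_left_of_degree_lt hlt, h2]
  · rwa [coeff_add, coeff_C_mul_X_pow, if_neg (by omega), add_zero]
  · rw [Polynomial.map_add, h4, Polynomial.map_mul, Polynomial.map_pow, map_X, map_C,
      iterateFrobenius_def, hc]

lemma sum_traceSign_eq_zero_of_shift {d j : ℕ} (M : Finset K[X])
    (hM : ∀ g, g ∈ M ↔ g ∈ fixedMonic (iterateFrobenius K 2 m) d)
    (hα : α ^ 2 ^ m = α) (hβ : β ^ 2 ^ m = β) (hγ : γ ^ 2 ^ m = γ) {c u : K} (hc : c ^ 2 ^ m = c)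
    (hj : 1 ≤ j) (hjd : j < d) (hu : u ^ 2 ^ m = u) (hu' : traceSign m u = -1)
    (h : ∀ g ∈ fixedMonic (iterateFrobenius K 2 m) d,
      rootSum α β γ (g + C c * X ^ j) = rootSum α β γ g + u) :
    ∑ g ∈ M, traceSign m (rootSum α β γ g) = 0 := by
  have hmem : ∀ g ∈ M, g + C c * X ^ j ∈ M := fun g hg =>
    (hM _).2 (add_C_mul_X_pow_mem_fixedMonic ((hM g).1 hg) hc hj hjd)
  have hinv : ∀ g ∈ M, g + C c * X ^ j + C c * X ^ j = g := fun g _ => by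
    rw [add_assoc, CharTwo.add_self_eq_zero, add_zero]
  have h1 : ∑ g ∈ M, traceSign m (rootSum α β γ g) = ∑ g ∈ M, -traceSign m (rootSum α β γ g) := by
    refine sum_nbij' (fun g => g + C c * X ^ j) (fun g => g + C c * X ^ j) hmem hmem hinv hinv ?_
    intro g hg
    rw [hM] at hg
    rw [h g hg, traceSign_add (rootSum_pow hα hβ hγ hg.2.2.2) hu, hu']
    ring
  rw [sum_neg_distrib] at h1
  linarith

omit [CharP K 2] in
lemma coeff_reverse_of_mem_fixedMonic {φ : K →+* K} {d i : ℕ} {g : K[X]} (hg : g ∈ fixedMonic φ d)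
    (hi : i ≤ d) : g.reverse.coeff i = g.coeff (d - i) := by
  rw [coeff_reverse, hg.2.1, revAt_le hi]

lemma sum_traceSign_fixedMonic_eq_zero [IsAlgClosed K] (hm : m ≠ 0) {d : ℕ} (M : Finset K[X])
    (hM : ∀ g, g ∈ M ↔ g ∈ fixedMonic (iterateFrobenius K 2 m) d)
    (hα : α ^ 2 ^ m = α) (hβ : β ^ 2 ^ m = β) (hγ : γ ^ 2 ^ m = γ) (hα0 : α ≠ 0) (hd : 5 ≤ d) :
    ∑ g ∈ M, traceSign m (rootSum α β γ g) = 0 := by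
  obtain ⟨u, hu, hu'⟩ := exists_traceSign_eq_neg_one (K := K) hm
  have hc : (u / α) ^ 2 ^ m = u / α := by rw [div_pow, hu, hα]
  refine sum_traceSign_eq_zero_of_shift M hM hα hβ hγ hc (j := d - 3) (by omega) (by omega) hu hu'
    fun g hg => ?_
  have hg' := add_C_mul_X_pow_mem_fixedMonic hg hc (j := d - 3) (by omega) (by omega)
  rw [rootSum, rootSum]
  simp only [coeff_reverse_of_mem_fixedMonic hg (by omega : 1 ≤ d),
    coeff_reverse_of_mem_fixedMonic hg (by omega : 2 ≤ d),
    coeff_reverse_of_mem_fixedMonic hg (by omega : 3 ≤ d),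
    coeff_reverse_of_mem_fixedMonic hg' (by omega : 1 ≤ d),
    coeff_reverse_of_mem_fixedMonic hg' (by omega : 2 ≤ d),
    coeff_reverse_of_mem_fixedMonic hg' (by omega : 3 ≤ d), coeff_add, coeff_C_mul_X_pow]
  rw [if_neg (by omega), if_neg (by omega), if_pos trivial, if_neg (by omega), if_neg (by omega)]
  field_simp
  ring

lemma sum_traceSign_fixedMonic_eq_zero' [IsAlgClosed K] (hm : m ≠ 0) {d : ℕ} (M : Finset K[X])
    (hM : ∀ g, g ∈ M ↔ g ∈ fixedMonic (iterateFrobenius K 2 m) d)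
    (hβ : β ^ 2 ^ m = β) (hγ : γ ^ 2 ^ m = γ) (hβ0 : β ≠ 0) (hd : 3 ≤ d) :
    ∑ g ∈ M, traceSign m (rootSum 0 β γ g) = 0 := by
  obtain ⟨u, hu, hu'⟩ := exists_traceSign_eq_neg_one (K := K) hm
  have hc : (u / β) ^ 2 ^ m = u / β := by rw [div_pow, hu, hβ]
  refine sum_traceSign_eq_zero_of_shift M hM (zero_pow (Nat.two_pow_pos m).ne') hβ hγ hc
    (j := d - 1) (by omega) (by omega) hu hu' fun g hg => ?_
  have hg' := add_C_mul_X_pow_mem_fixedMonic hg hc (j := d - 1) (by omega) (by omega)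
  rw [rootSum, rootSum]
  simp only [coeff_reverse_of_mem_fixedMonic hg (by omega : 1 ≤ d),
    coeff_reverse_of_mem_fixedMonic hg' (by omega : 1 ≤ d), coeff_add, coeff_C_mul_X_pow, zero_mul]
  rw [if_pos trivial, if_neg (by omega), if_neg (by omega)]
  field_simp
  ring

/-- The Weil bound, given the degree of the `L`-function. -/
lemma abs_sum_traceSign_le_mul_sqrt [IsAlgClosed K] (hm : m ≠ 0) (D : ℕ)
    (hα : α ^ 2 ^ m = α) (hβ : β ^ 2 ^ m = β) (hγ : γ ^ 2 ^ m = γ) (hαβ : α ≠ 0 ∨ β ≠ 0)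
    (hD : ∀ d, D < d → ∀ M : Finset K[X],
      (∀ g, g ∈ M ↔ g ∈ fixedMonic (iterateFrobenius K 2 m) d) →
        ∑ g ∈ M, traceSign m (rootSum α β γ g) = 0)
    (P : Finset K) (hP : ∀ x, x ∈ P ↔ x ≠ 0 ∧ x ^ 2 ^ m = x) :
    |((∑ x ∈ P, traceSign m (laurentCubic α β γ x) : ℤ) : ℝ)| ≤ D * √(2 ^ m) := by
  classical
  set φ := iterateFrobenius K 2 m
  have hfin : {x | φ x = x}.Finite := by
    refine (frobFixed K m).finite_toSet.subset fun x hx => ?_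
    rw [mem_coe, mem_frobFixed hm]
    rwa [Set.mem_ofPred_eq, iterateFrobenius_def] at hx
  let M : ℕ → Finset K[X] := fun d => (fixedMonic_finite φ hfin d).toFinset
  have hM : ∀ d g, g ∈ M d ↔ g ∈ fixedMonic φ d := fun d g => Set.Finite.mem_toFinset _
  let R : ℕ → Finset K := fun k => (frobFixed K (m * k)).erase 0
  have hR : ∀ k, 1 ≤ k → ∀ x, x ∈ R k ↔ x ≠ 0 ∧ x ^ 2 ^ (m * k) = x := fun k hk x => by
    rw [mem_erase, mem_frobFixed (Nat.mul_ne_zero hm (by omega))]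
  have hR' : ∀ k, 1 ≤ k → ∀ x, x ∈ R k ↔ x ≠ 0 ∧ φ^[k] x = x := fun k hk x => by
    rw [hR k hk, iterate_iterateFrobenius]
  have hΛ : ∀ i j, ∀ g ∈ fixedMonic φ i, ∀ h ∈ fixedMonic φ j,
      traceSign m (rootSum α β γ (g * h)) =
        traceSign m (rootSum α β γ g) * traceSign m (rootSum α β γ h) := by
    intro i j g hg h hh
    rw [rootSum_mul α β γ hg.1 hh.1 hg.2.2.1 hh.2.2.1,
      traceSign_add (rootSum_pow hα hβ hγ hg.2.2.2) (rootSum_pow hα hβ hγ hh.2.2.2)]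
  have hN := newton_fixedMonic φ M hM R hR' (fun g => traceSign m (rootSum α β γ g)) hΛ
  let c : ℕ → ℝ := fun d => ((∑ g ∈ M d, traceSign m (rootSum α β γ g) : ℤ) : ℝ)
  let S : ℕ → ℝ := fun k => ((∑ x ∈ R k, traceSign (m * k) (laurentCubic α β γ x) : ℤ) : ℝ)
  have hS : ∀ k, 1 ≤ k → ∑ x ∈ R k, traceSign m (rootSum α β γ (orbitPoly φ k x)) =
      ∑ x ∈ R k, traceSign (m * k) (laurentCubic α β γ x) := fun k hk =>
    sum_congr rfl fun x hx => traceSign_rootSum_orbitPoly hα hβ hγ k ((hR k hk x).1 hx).1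
  have hM0 : M 0 = {1} := by
    ext g
    rw [hM, mem_singleton]
    constructor
    · intro h
      exact h.1.natDegree_eq_zero.1 h.2.1
    · rintro rfl
      exact ⟨monic_one, natDegree_one, by simp, Polynomial.map_one _⟩
  have hc0 : c 0 = 1 := by
    simp only [c, hM0, sum_singleton, rootSum_one, traceSign_zero_right, Int.cast_one]
  have hcD : ∀ d, D < d → c d = 0 := fun d hd => by
    simp only [c, hD d hd (M d) (hM d), Int.cast_zero]
  have hN' : ∀ d : ℕ, 1 ≤ d → (d : ℝ) * c d = ∑ j ∈ range d, c j * S (d - j) := by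
    intro d _
    have h1 := (hN d).trans (sum_congr rfl fun j hj =>
      congrArg _ (hS (d - j) (Nat.sub_pos_of_lt (mem_range.1 hj))))
    simp only [c, S]
    exact_mod_cast h1
  have hq : (0 : ℝ) < 2 ^ m := by positivity
  have hbound : ∀ n, 3 ≤ n → |S (2 * n)| ≤ 8 * √(2 ^ m) ^ (2 * n) := by
    intro n hn
    obtain ⟨r, hr⟩ : ∃ r, m * n = r + 1 :=
      Nat.exists_eq_succ_of_ne_zero (Nat.mul_ne_zero hm (by omega))
    have hr2 : 2 ≤ r := by
      have : 1 * n ≤ m * n := Nat.mul_le_mul_right _ (Nat.pos_of_ne_zero hm)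
      omega
    have hmn : m * (2 * n) = 2 * (r + 1) := by rw [← hr]; ring
    have hfix : ∀ y : K, y ^ 2 ^ m = y → y ^ 2 ^ (2 * (r + 1)) = y := by
      intro y hy
      rw [← hmn, ← iterate_iterateFrobenius]
      exact Function.iterate_fixed (by rwa [iterateFrobenius_def]) _
    have h1 := abs_sum_traceSign_laurentCubic_le hαβ hr2 (R (2 * n))
      (fun x => by rw [hR _ (by omega), hmn]) (hfix α hα) (hfix β hβ) (hfix γ hγ)
    have h2 : √((2 : ℝ) ^ m) ^ (2 * n) = 2 ^ (r + 1) := by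
      rw [pow_mul, Real.sq_sqrt hq.le, ← pow_mul, hr]
    rw [h2]
    simp only [S, hmn]
    exact_mod_cast h1
  have h1 := abs_coeff_one_le_of_newton c S hc0 hcD hN' (Real.sqrt_pos.2 hq) (by norm_num) 3 hbound
  have h2 := hN' 1 le_rfl
  rw [sum_range_one, hc0, Nat.cast_one, one_mul, one_mul, Nat.sub_zero] at h2
  have h3 : R 1 = P := by
    ext x
    rw [hR 1 le_rfl, hP, mul_one]
  rw [h2] at h1
  simpa only [S, h3, mul_one] using h1

end WeilBound

section FiniteFieldSums

open Finset

variable {F : Type*} [Field F] [Fintype F] [DecidableEq F] {m : ℕ}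

omit [DecidableEq F] in
lemma pow_two_pow_eq_self (hF : Fintype.card F = 2 ^ m) (x : F) : x ^ 2 ^ m = x := by
  rw [← hF, FiniteField.pow_card]

variable [CharP F 2]

omit [DecidableEq F] in
lemma exists_preimage_algebraicClosure (hF : Fintype.card F = 2 ^ m) (hm : m ≠ 0)
    {x : AlgebraicClosure F} (hx : x ^ 2 ^ m = x) :
    ∃ y : F, algebraMap F (AlgebraicClosure F) y = x := by
  classical
  have : CharP (AlgebraicClosure F) 2 := charP_of_injective_algebraMap
    (algebraMap F (AlgebraicClosure F)).injective 2
  have h1 : univ.image (algebraMap F (AlgebraicClosure F)) = frobFixed (AlgebraicClosure F) m := by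
    refine eq_of_subset_of_card_le ?_ ?_
    · intro y hy
      obtain ⟨z, -, rfl⟩ := mem_image.1 hy
      rw [mem_frobFixed hm, ← map_pow, pow_two_pow_eq_self hF]
    · rw [card_frobFixed hm, card_image_of_injective _ (algebraMap F _).injective, card_univ, hF]
  rw [← mem_frobFixed hm, ← h1, mem_image] at hx
  obtain ⟨y, -, hy⟩ := hx
  exact ⟨y, hy⟩

lemma sum_traceSign_laurentCubic_eq (hF : Fintype.card F = 2 ^ m) (hm : m ≠ 0) :
    ∃ P : Finset (AlgebraicClosure F), (∀ x, x ∈ P ↔ x ≠ 0 ∧ x ^ 2 ^ m = x) ∧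
      ∀ α β γ : F, ∑ x ∈ univ.erase (0 : F), traceSign m (laurentCubic α β γ x) =
        ∑ x ∈ P, traceSign m (laurentCubic (algebraMap F (AlgebraicClosure F) α)
          (algebraMap F (AlgebraicClosure F) β) (algebraMap F (AlgebraicClosure F) γ) x) := by
  classical
  let e := algebraMap F (AlgebraicClosure F)
  refine ⟨(univ.erase 0).image e, fun x => ?_, fun α β γ => ?_⟩
  · constructor
    · intro hx
      obtain ⟨y, hy, rfl⟩ := mem_image.1 hx
      refine ⟨(map_ne_zero e).2 (ne_of_mem_erase hy), ?_⟩
      rw [← map_pow, pow_two_pow_eq_self hF]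
    · rintro ⟨hx0, hx⟩
      obtain ⟨y, rfl⟩ := exists_preimage_algebraicClosure hF hm hx
      exact mem_image_of_mem e (mem_erase.2 ⟨(map_ne_zero e).1 hx0, mem_univ _⟩)
  · rw [sum_image fun x _ y _ h => e.injective h]
    refine sum_congr rfl fun x _ => ?_
    rw [← map_laurentCubic, traceSign_map]

lemma abs_le_floor_of_abs_le {S : ℤ} {y : ℝ} (h : |(S : ℝ)| ≤ y) : |S| ≤ ⌊y⌋ := by
  rw [Int.le_floor]
  exact_mod_cast h

lemma abs_sum_traceSign_cubic_le (hF : Fintype.card F = 2 ^ m) (hm : m ≠ 0) {α : F} (hα : α ≠ 0)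
    (β γ : F) :
    |∑ x ∈ univ.erase (0 : F), traceSign m (laurentCubic α β γ x)| ≤ ⌊4 * √(2 ^ m)⌋ := by
  have : CharP (AlgebraicClosure F) 2 := charP_of_injective_algebraMap
    (algebraMap F (AlgebraicClosure F)).injective 2
  obtain ⟨P, hP, hsum⟩ := sum_traceSign_laurentCubic_eq hF hm
  have hfix : ∀ y : F, algebraMap F (AlgebraicClosure F) y ^ 2 ^ m = algebraMap F _ y := fun y => by
    rw [← map_pow, pow_two_pow_eq_self hF]
  refine abs_le_floor_of_abs_le ?_
  have hα' := (map_ne_zero (algebraMap F (AlgebraicClosure F))).2 hα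
  rw [hsum]
  exact_mod_cast abs_sum_traceSign_le_mul_sqrt hm 4 (hfix α) (hfix β) (hfix γ) (Or.inl hα')
    (fun d hd M hM => sum_traceSign_fixedMonic_eq_zero hm M hM (hfix α) (hfix β) (hfix γ) hα' hd)
    P hP

lemma abs_sum_traceSign_linear_le (hF : Fintype.card F = 2 ^ m) (hm : m ≠ 0) {β : F} (hβ : β ≠ 0)
    (γ : F) : |∑ x ∈ univ.erase (0 : F), traceSign m (laurentCubic 0 β γ x)| ≤ ⌊2 * √(2 ^ m)⌋ := by
  have : CharP (AlgebraicClosure F) 2 := charP_of_injective_algebraMap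
    (algebraMap F (AlgebraicClosure F)).injective 2
  obtain ⟨P, hP, hsum⟩ := sum_traceSign_laurentCubic_eq hF hm
  have hfix : ∀ y : F, algebraMap F (AlgebraicClosure F) y ^ 2 ^ m = algebraMap F _ y := fun y => by
    rw [← map_pow, pow_two_pow_eq_self hF]
  refine abs_le_floor_of_abs_le ?_
  have hβ' := (map_ne_zero (algebraMap F (AlgebraicClosure F))).2 hβ
  rw [hsum, map_zero]
  exact_mod_cast abs_sum_traceSign_le_mul_sqrt hm 2 (zero_pow (Nat.two_pow_pos m).ne') (hfix β)
    (hfix γ) (Or.inr hβ')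
    (fun d hd M hM => sum_traceSign_fixedMonic_eq_zero' hm M hM (hfix β) (hfix γ) hβ' hd) P hP

variable (hF : Fintype.card F = 2 ^ m)
include hF

omit [DecidableEq F] in
lemma traceSign_add' (y z : F) : traceSign m (y + z) = traceSign m y * traceSign m z :=
  traceSign_add (pow_two_pow_eq_self hF y) (pow_two_pow_eq_self hF z)

omit [DecidableEq F] in
lemma traceSign_add_sq_add (y z : F) : traceSign m (y + (z ^ 2 + z)) = traceSign m y := by
  rw [traceSign_add' hF, traceSign_sq_add (pow_two_pow_eq_self hF z), mul_one]

omit [DecidableEq F] in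
lemma exists_traceSign_eq_neg_one' (hm : m ≠ 0) : ∃ c : F, traceSign m c = -1 := by
  have : CharP (AlgebraicClosure F) 2 := charP_of_injective_algebraMap
    (algebraMap F (AlgebraicClosure F)).injective 2
  obtain ⟨c, hc, hc'⟩ := exists_traceSign_eq_neg_one (K := AlgebraicClosure F) hm
  obtain ⟨y, rfl⟩ := exists_preimage_algebraicClosure hF hm hc
  exact ⟨y, by rwa [traceSign_map] at hc'⟩

omit [DecidableEq F] in
lemma sum_traceSign_eq_zero (hm : m ≠ 0) : ∑ x : F, traceSign m x = 0 := by
  obtain ⟨c, hc⟩ := exists_traceSign_eq_neg_one' hF hm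
  have h := Equiv.sum_comp (Equiv.addRight c) (traceSign m)
  simp only [Equiv.coe_addRight, traceSign_add' hF, hc, mul_neg, mul_one, sum_neg_distrib] at h
  linarith

omit [DecidableEq F] in
lemma sum_traceSign_mul_eq_zero (hm : m ≠ 0) {u : F} (hu : u ≠ 0) :
    ∑ x : F, traceSign m (u * x) = 0 := by
  rw [← sum_traceSign_eq_zero hF hm]
  exact Equiv.sum_comp (Equiv.mulLeft₀ u hu) (traceSign m)

lemma sum_traceSign_mul_sq (hm : m ≠ 0) (u : F) :
    ∑ x : F, traceSign m (u * x ^ 2) = if u = 0 then 2 ^ m else 0 := by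
  have h : ∑ x : F, traceSign m (u * x ^ 2) = ∑ x : F, traceSign m (u * x) :=
    Function.Bijective.sum_comp (e := fun x : F => x ^ 2) (bijective_frobenius F 2)
      (fun x => traceSign m (u * x))
  rw [h]
  split_ifs with hu
  · simp [hu, traceSign_zero_right, hF]
  · exact sum_traceSign_mul_eq_zero hF hm hu

lemma card_sq_add_eq (hm : m ≠ 0) (y : F) : (#{x : F | x ^ 2 + x = y} : ℤ) = 1 + traceSign m y := by
  have hle : ∀ y ∈ (univ : Finset F), (#{x : F | x ^ 2 + x = y} : ℤ) ≤ 1 + traceSign m y := by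
    intro y _
    by_cases h : ∃ x : F, x ^ 2 + x = y
    · obtain ⟨x, rfl⟩ := h
      rw [traceSign_sq_add (pow_two_pow_eq_self hF x)]
      have hsub : ({x' : F | x' ^ 2 + x' = x ^ 2 + x} : Finset F) ⊆ {x, x + 1} := by
        intro z hz
        rw [mem_filter] at hz
        have h1 : (z - x) * (z - (x + 1)) = 0 := by
          linear_combination hz.2 - (z * x - x ^ 2 + z - x) * CharTwo.two_eq_zero (R := F)
        rw [mem_insert, mem_singleton]
        exact (mul_eq_zero.1 h1).imp sub_eq_zero.1 sub_eq_zero.1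
      exact_mod_cast (card_le_card hsub).trans card_le_two
    · push Not at h
      rw [filter_false_of_mem fun x _ => h x]
      rcases traceSign_eq_one_or m y with h' | h' <;> simp [h']
  have hsum : ∑ y : F, (#{x : F | x ^ 2 + x = y} : ℤ) = ∑ y : F, (1 + traceSign m y) := by
    rw [sum_add_distrib, sum_traceSign_eq_zero hF hm, ← Nat.cast_sum,
      ← card_eq_sum_card_fiberwise (f := fun x : F => x ^ 2 + x) (s := univ) (t := univ)
        fun x _ => mem_coe.2 (mem_univ _)]
    simp
  exact (sum_eq_sum_iff_of_le hle).1 hsum y (mem_univ y)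

/-- Composition with the Artin–Schreier map. -/
lemma sum_comp_sq_add (hm : m ≠ 0) (f : F → ℤ) :
    ∑ s : F, f (s ^ 2 + s) = ∑ y : F, (1 + traceSign m y) * f y := by
  rw [← sum_fiberwise (s := univ) (g := fun s : F => s ^ 2 + s)]
  refine sum_congr rfl fun y _ => ?_
  rw [← card_sq_add_eq hF hm, ← nsmul_eq_mul, ← sum_const]
  refine sum_congr rfl fun s hs => ?_
  rw [(mem_filter.1 hs).2]

lemma sq_sum_traceSign_cubic (hm : m ≠ 0) {a : F} (ha : a ≠ 0) (b c : F) :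
    (∑ x : F, traceSign m (a * x ^ 3 + b * x ^ 2 + c * x)) ^ 2 ≤
      2 ^ m * #{h : F | h = 0 ∨ h ^ 3 = a⁻¹} := by
  have h2 : (2 : F) = 0 := CharTwo.two_eq_zero
  have h1 : (∑ x : F, traceSign m (a * x ^ 3 + b * x ^ 2 + c * x)) ^ 2 =
      ∑ h : F, traceSign m (a * h ^ 3 + b * h ^ 2 + c * h) *
        ∑ x : F, traceSign m ((a * h + a ^ 2 * h ^ 4) * x ^ 2) := by
    rw [sq, sum_mul_sum]
    have h3 : ∀ x : F, ∑ y : F, traceSign m (a * x ^ 3 + b * x ^ 2 + c * x) *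
        traceSign m (a * y ^ 3 + b * y ^ 2 + c * y) =
        ∑ h : F, traceSign m (a * h ^ 3 + b * h ^ 2 + c * h) *
          traceSign m ((a * h + a ^ 2 * h ^ 4) * x ^ 2) := by
      intro x
      rw [← Equiv.sum_comp (Equiv.addLeft x)]
      refine sum_congr rfl fun h _ => ?_
      rw [← traceSign_add' hF, ← traceSign_add' hF, ← traceSign_add_sq_add hF _ (a * h ^ 2 * x)]
      congr 1
      simp only [Equiv.coe_addLeft]
      linear_combination (a * x ^ 3 + b * x ^ 2 + c * x + a * x ^ 2 * h + 2 * a * x * h ^ 2 +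
        b * x * h + a ^ 2 * h ^ 4 * x ^ 2 - a ^ 2 * h ^ 4 * x ^ 2) * h2
    rw [sum_congr rfl fun x _ => h3 x, sum_comm]
    simp_rw [mul_sum]
  rw [h1]
  simp_rw [sum_traceSign_mul_sq hF hm]
  calc _ ≤ ∑ h : F, if h = 0 ∨ h ^ 3 = a⁻¹ then (2 ^ m : ℤ) else 0 := by
        refine sum_le_sum fun h _ => ?_
        split_ifs with h3 h4 h4
        · rcases traceSign_eq_one_or m (a * h ^ 3 + b * h ^ 2 + c * h) with h' | h' <;> rw [h'] <;>
            linarith [pow_pos (two_pos : (0 : ℤ) < 2) m]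
        · exfalso
          apply h4
          have h5 : a * h * (1 + a * h ^ 3) = 0 := by linear_combination h3
          rcases mul_eq_zero.1 h5 with h6 | h6
          · exact Or.inl ((mul_eq_zero.1 h6).resolve_left ha)
          · right
            rw [CharTwo.add_eq_zero] at h6
            exact eq_inv_of_mul_eq_one_right h6.symm
        · rw [mul_zero]; positivity
        · rw [mul_zero]
    _ = _ := by
        rw [← sum_filter, sum_const, nsmul_eq_mul, mul_comm]

omit [CharP F 2] [Fintype F] hF in
lemma card_nthRoots_toFinset_three_le [Fintype F] (a : F) :
    #{h : F | h = 0 ∨ h ^ 3 = a⁻¹} ≤ 4 := by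
  have h1 : ({h : F | h = 0 ∨ h ^ 3 = a⁻¹} : Finset F) ⊆
      insert 0 (Polynomial.nthRoots 3 a⁻¹).toFinset := by
    intro h hh
    rw [mem_filter] at hh
    rw [mem_insert, Multiset.mem_toFinset, Polynomial.mem_nthRoots (by norm_num)]
    exact hh.2
  refine (card_le_card h1).trans ((card_insert_le _ _).trans ?_)
  have := (Multiset.toFinset_card_le (Polynomial.nthRoots 3 a⁻¹)).trans
    (Polynomial.card_nthRoots 3 a⁻¹)
  omega

omit [CharP F 2] in
lemma card_cube_roots_le_of_odd (hm : Odd m) {a : F} (ha : a ≠ 0) :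
    #{h : F | h = 0 ∨ h ^ 3 = a⁻¹} ≤ 2 := by
  obtain ⟨k, rfl⟩ := hm
  have hinj : ∀ x y : F, x ^ 3 = a⁻¹ → y ^ 3 = a⁻¹ → x = y := by
    intro x y hx hy
    have hy0 : y ≠ 0 := by
      rintro rfl
      exact inv_ne_zero ha (by rw [← hy]; simp)
    have hz3 : (x / y) ^ 3 = 1 := by rw [div_pow, hx, hy, div_self (inv_ne_zero ha)]
    obtain ⟨t, ht⟩ : ∃ t, 2 ^ (2 * k + 1) = 3 * t + 2 := by
      clear hF
      induction k with
      | zero => exact ⟨0, rfl⟩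
      | succ k ih =>
        obtain ⟨t, ht⟩ := ih
        refine ⟨4 * t + 2, ?_⟩
        rw [show 2 * (k + 1) + 1 = 2 * k + 1 + 2 by ring, pow_add, ht]
        ring
    have hz := pow_two_pow_eq_self hF (x / y)
    rw [ht, pow_add, pow_mul, hz3, one_pow, one_mul] at hz
    have hz0 : x / y ≠ 0 := by
      intro h
      rw [h] at hz3
      simp at hz3
    have hz1 : x / y = 1 := mul_left_cancel₀ hz0 (by rw [← sq, hz, mul_one])
    exact (div_eq_one_iff_eq hy0).1 hz1
  rw [filter_or]
  refine (card_union_le _ _).trans ?_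
  have h1 : #{h : F | h = 0} ≤ 1 := card_le_one.2 fun x hx y hy => by
    rw [(mem_filter.1 hx).2, (mem_filter.1 hy).2]
  have h2 : #{h : F | h ^ 3 = a⁻¹} ≤ 1 := card_le_one.2 fun x hx y hy =>
    hinj x y (mem_filter.1 hx).2 (mem_filter.1 hy).2
  omega

end FiniteFieldSums

section Counting

open Finset

variable {F : Type*} [Field F] [Fintype F] [DecidableEq F] {m : ℕ}

omit [Field F] in
lemma card_filter_image_eq {s : Finset F} (hs : #s = 4) :
    #{v : Fin 4 → F | Function.Injective v ∧ univ.image v = s} = 24 := by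
  have h1 : Fintype.card (Fin 4 ≃ s) = 24 := by
    rw [Fintype.card_equiv (Fintype.equivOfCardEq (by simp [hs]))]
    rfl
  rw [← h1, ← card_univ]
  symm
  refine card_nbij (fun e i => (e i : F)) ?_ ?_ ?_
  · intro e _
    rw [mem_coe, mem_filter]
    refine ⟨mem_univ _, fun i j h => e.injective (Subtype.ext h), ?_⟩
    ext x
    rw [mem_image]
    constructor
    · rintro ⟨i, -, rfl⟩
      exact (e i).2
    · intro hx
      exact ⟨e.symm ⟨x, hx⟩, mem_univ _, by simp⟩
  · intro e _ e' _ h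
    ext i
    exact congrFun h i
  · intro v hv
    rw [mem_coe, mem_filter] at hv
    obtain ⟨-, hinj, him⟩ := hv
    have hmem : ∀ i, v i ∈ s := fun i => him ▸ mem_image_of_mem v (mem_univ i)
    refine ⟨Equiv.ofBijective (fun i => ⟨v i, hmem i⟩) ⟨?_, ?_⟩, by simp, rfl⟩
    · intro i j h
      exact hinj (congrArg Subtype.val h)
    · rintro ⟨x, hx⟩
      rw [← him, mem_image] at hx
      obtain ⟨i, -, rfl⟩ := hx
      exact ⟨i, rfl⟩

lemma twentyfour_mul_ncard (A B : F) :
    24 * Set.ncard {s : Finset F | #s = 4 ∧ ∑ x ∈ s, x = 1 ∧ ∑ x ∈ s, x ^ 3 = A ∧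
      ∑ x ∈ s, x ^ 5 = B} =
    #{v : Fin 4 → F | Function.Injective v ∧ ∑ i, v i = 1 ∧ ∑ i, v i ^ 3 = A ∧
      ∑ i, v i ^ 5 = B} := by
  have h1 : {s : Finset F | #s = 4 ∧ ∑ x ∈ s, x = 1 ∧ ∑ x ∈ s, x ^ 3 = A ∧ ∑ x ∈ s, x ^ 5 = B} =
      (({s : Finset F | #s = 4 ∧ ∑ x ∈ s, x = 1 ∧ ∑ x ∈ s, x ^ 3 = A ∧
        ∑ x ∈ s, x ^ 5 = B} : Finset (Finset F)) : Set (Finset F)) := by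
    ext s
    simp
  have h2 : ∀ v : Fin 4 → F, Function.Injective v → ∀ k : ℕ,
      ∑ x ∈ univ.image v, x ^ k = ∑ i, v i ^ k := fun v hv k =>
    sum_image fun i _ j _ h => hv h
  have h2' : ∀ v : Fin 4 → F, Function.Injective v → ∑ x ∈ univ.image v, x = ∑ i, v i :=
    fun v hv => sum_image fun i _ j _ h => hv h
  rw [h1, Set.ncard_coe_finset, card_eq_sum_card_fiberwise (f := fun v => univ.image v)
    (t := {s : Finset F | #s = 4 ∧ ∑ x ∈ s, x = 1 ∧ ∑ x ∈ s, x ^ 3 = A ∧ ∑ x ∈ s, x ^ 5 = B})]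
  · rw [sum_congr rfl (g := fun _ => 24), sum_const, smul_eq_mul, mul_comm]
    intro s hs
    obtain ⟨-, h4, hs1, hs3, hs5⟩ := mem_filter.1 hs
    rw [← card_filter_image_eq h4, filter_filter]
    congr 1
    refine filter_congr fun v _ => ?_
    constructor
    · rintro ⟨⟨h, -⟩, h'⟩
      exact ⟨h, h'⟩
    · rintro ⟨h, rfl⟩
      rw [h2 v h] at hs3 hs5
      rw [h2' v h] at hs1
      exact ⟨⟨h, hs1, hs3, hs5⟩, rfl⟩
  · intro v hv
    obtain ⟨-, h, hv1, hv3, hv5⟩ := mem_filter.1 (mem_coe.1 hv)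
    rw [mem_coe, mem_filter, h2 v h, h2 v h, h2' v h, card_image_of_injective _ h]
    exact ⟨mem_univ _, by simp, hv1, hv3, hv5⟩

variable [CharP F 2]

omit [Fintype F] [DecidableEq F] in
lemma sum_cubes_eq (x s r : F) : x ^ 3 + (x + s) ^ 3 + (x + r) ^ 3 + (x + s + r + 1) ^ 3 =
    x ^ 2 + x + 1 + (s + r) * (s + 1) * (r + 1) := by
  have h2 : (2 : F) = 0 := CharTwo.two_eq_zero
  linear_combination (
    2*x^3 + 3*x^2*s + 3*x^2*r + x^2 + 3*x*s^2 + 3*x*s*r + 3*x*s + 3*x*r^2 + 3*x*r + x + s^3 +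
    s^2*r + s^2 + s*r^2 + 2*s*r + s + r^3 + r^2 + r) * h2

omit [Fintype F] [DecidableEq F] in
lemma sum_fifths_eq (x s r : F) : x ^ 5 + (x + s) ^ 5 + (x + r) ^ 5 + (x + s + r + 1) ^ 5 +
    (x ^ 2 + x + 1 + (s + r) * (s + 1) * (r + 1)) ^ 2 +
    (x ^ 2 + x + 1 + (s + r) * (s + 1) * (r + 1)) + 1 =
    (s ^ 2 + s) * ((r ^ 2 + r) * ((s + r) ^ 2 + (s + r))) := by
  have h2 : (2 : F) = 0 := CharTwo.two_eq_zero
  linear_combination (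
    2*x^5 + 5*x^4*s + 5*x^4*r + 3*x^4 + 10*x^3*s^2 + 10*x^3*s*r + 10*x^3*s + 10*x^3*r^2 +
    10*x^3*r + 6*x^3 + 10*x^2*s^3 + 16*x^2*s^2*r + 16*x^2*s^2 + 16*x^2*s*r^2 + 32*x^2*s*r +
    16*x^2*s + 10*x^2*r^3 + 16*x^2*r^2 + 16*x^2*r + 7*x^2 + 5*x*s^4 + 10*x*s^3*r + 10*x*s^3 +
    15*x*s^2*r^2 + 31*x*s^2*r + 16*x*s^2 + 10*x*s*r^3 + 31*x*s*r^2 + 32*x*s*r + 11*x*s +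
    5*x*r^4 + 10*x*r^3 + 16*x*r^2 + 11*x*r + 4*x + s^5 + 3*s^4*r + 3*s^4 + 6*s^3*r^2 +
    12*s^3*r + 6*s^3 + 6*s^2*r^3 + 18*s^2*r^2 + 19*s^2*r + 7*s^2 + 3*s*r^4 + 12*s*r^3 +
    19*s*r^2 + 14*s*r + 4*s + r^5 + 3*r^4 + 6*r^3 + 7*r^2 + 4*r + 2) * h2

lemma card_injective_eq_card_triples {A B l : F} (hl : l = B + A ^ 2 + A + 1) (hl0 : l ≠ 0) :
    #{v : Fin 4 → F | Function.Injective v ∧ ∑ i, v i = 1 ∧ ∑ i, v i ^ 3 = A ∧ ∑ i, v i ^ 5 = B} =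
    #{p : F × F × F | (p.1 ^ 2 + p.1) * ((p.2.1 ^ 2 + p.2.1) *
      ((p.1 + p.2.1) ^ 2 + (p.1 + p.2.1))) = l ∧
      p.2.2 ^ 2 + p.2.2 = A + 1 + (p.1 + p.2.1) * (p.1 + 1) * (p.2.1 + 1)} := by
  have h2 : (2 : F) = 0 := CharTwo.two_eq_zero
  refine card_nbij' (fun v => (v 0 + v 1, v 0 + v 2, v 0))
    (fun p => ![p.2.2, p.2.2 + p.1, p.2.2 + p.2.1, p.2.2 + p.1 + p.2.1 + 1]) ?_ ?_ ?_ ?_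
  · intro v hv
    obtain ⟨-, -, hv1, hv3, hv5⟩ := mem_filter.1 (mem_coe.1 hv)
    rw [Fin.sum_univ_four] at hv1 hv3 hv5
    rw [mem_coe, mem_filter]
    simp only [mem_univ, true_and]
    generalize v 0 = x at *
    generalize v 1 = y at *
    generalize v 2 = z at *
    generalize v 3 = w at *
    obtain ⟨s, rfl⟩ : ∃ s, y = x + s := ⟨y - x, by ring⟩
    obtain ⟨r, rfl⟩ : ∃ r, z = x + r := ⟨z - x, by ring⟩
    obtain rfl : w = x + s + r + 1 := by linear_combination hv1 - (2 * x + s + r) * h2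
    simp only [CharTwo.add_cancel_left]
    have h5 := sum_fifths_eq x s r
    rw [hv5, ← sum_cubes_eq x s r, hv3] at h5
    rw [sum_cubes_eq] at hv3
    refine ⟨by rw [← h5, hl], ?_⟩
    linear_combination hv3 - (1 + (s + r) * (s + 1) * (r + 1)) * h2
  · rintro ⟨s, r, x⟩ hp
    obtain ⟨-, hp1, hp2⟩ := mem_filter.1 (mem_coe.1 hp)
    simp only at hp1 hp2
    rw [mem_coe, mem_filter]
    refine ⟨mem_univ _, ?_, ?_, ?_, ?_⟩
    · have hs0 : s ≠ 0 := by rintro rfl; exact hl0 (by rw [← hp1]; ring)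
      have hr0 : r ≠ 0 := by rintro rfl; exact hl0 (by rw [← hp1]; ring)
      have hs1 : s ≠ 1 := by
        rintro rfl; exact hl0 (by
          linear_combination -hp1 + (r ^ 2 + r) * ((1 + r) ^ 2 + (1 + r)) * h2)
      have hr1 : r ≠ 1 := by
        rintro rfl; exact hl0 (by
          linear_combination -hp1 + (s ^ 2 + s) * ((s + 1) ^ 2 + (s + 1)) * h2)
      have hsr0 : s + r ≠ 0 := fun h => hl0 (by rw [← hp1, h]; ring)
      have hsr1 : s + r ≠ 1 := fun h => hl0 (by
        rw [h] at hp1; linear_combination -hp1 + (s ^ 2 + s) * (r ^ 2 + r) * h2)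
      have hsr : s ≠ r := fun h => hsr0 (by rw [h]; exact CharTwo.add_self_eq_zero r)
      have hsr' : s + r + 1 ≠ 0 := fun h => hsr1 (by linear_combination h - h2)
      have hs1' : s + 1 ≠ 0 := fun h => hs1 (by linear_combination h - h2)
      have hr1' : r + 1 ≠ 0 := fun h => hr1 (by linear_combination h - h2)
      have hne : ∀ a b c : F, c ≠ 0 → a + b = c → a ≠ b := by
        rintro a b c hc h rfl
        exact hc (by rw [← h]; exact CharTwo.add_self_eq_zero a)
      have h01 : x ≠ x + s := hne _ _ s hs0 (by linear_combination x * h2)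
      have h02 : x ≠ x + r := hne _ _ r hr0 (by linear_combination x * h2)
      have h03 : x ≠ x + s + r + 1 := hne _ _ _ hsr' (by linear_combination x * h2)
      have h12 : x + s ≠ x + r := hne _ _ _ hsr0 (by linear_combination x * h2)
      have h13 : x + s ≠ x + s + r + 1 := hne _ _ _ hr1' (by linear_combination (x + s) * h2)
      have h23 : x + r ≠ x + s + r + 1 := hne _ _ _ hs1' (by linear_combination (x + r) * h2)
      intro i j hij
      fin_cases i <;> fin_cases j <;> simp_all
    · simp [Fin.sum_univ_four]
      linear_combination (2 * x + s + r) * h2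
    · simp [Fin.sum_univ_four]
      rw [sum_cubes_eq, add_assoc, add_assoc, ← add_assoc, hp2]
      linear_combination (1 + (s + r) * (s + 1) * (r + 1)) * h2
    · simp [Fin.sum_univ_four]
      have h5 := sum_fifths_eq x s r
      have h3 : x ^ 2 + x + 1 + (s + r) * (s + 1) * (r + 1) = A := by
        linear_combination hp2 + (1 + (s + r) * (s + 1) * (r + 1)) * h2
      rw [h3, hp1, hl] at h5
      linear_combination h5
  · intro v hv
    obtain ⟨-, -, hv1, -, -⟩ := mem_filter.1 (mem_coe.1 hv)
    rw [Fin.sum_univ_four] at hv1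
    funext i
    fin_cases i
    · rfl
    · simp
      linear_combination v 0 * h2
    · simp
      linear_combination v 0 * h2
    · simp
      linear_combination -hv1 + (2 * v 0 + v 1 + v 2) * h2
  · rintro ⟨s, r, x⟩ _
    simp only [Matrix.cons_val_zero, Matrix.cons_val_one, Matrix.cons_val]
    refine Prod.ext ?_ (Prod.ext ?_ rfl)
    · simp only
      linear_combination x * h2
    · simp only
      linear_combination x * h2

end Counting

section Triples

open Finset

variable {F : Type*} [Field F] [Fintype F] [DecidableEq F] [CharP F 2] {m : ℕ}

lemma card_sq_add_mul_eq (hF : Fintype.card F = 2 ^ m) (hm : m ≠ 0) {t : F} (ht : t ≠ 0)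
    (y : F) : (#{x : F | x ^ 2 + t * x = y} : ℤ) = 1 + traceSign m (y / t ^ 2) := by
  rw [← card_sq_add_eq hF hm]
  congr 1
  refine card_nbij' (fun x => x / t) (fun x => t * x) ?_ ?_ ?_ ?_
  · intro x hx
    simp only [mem_coe, mem_filter, mem_univ, true_and] at hx ⊢
    rw [← hx]
    field_simp
  · intro x hx
    simp only [mem_coe, mem_filter, mem_univ, true_and] at hx ⊢
    rw [eq_div_iff (pow_ne_zero 2 ht)] at hx
    rw [← hx]
    ring
  · intro x _
    simp only
    field_simp
  · intro x _
    simp only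
    field_simp

lemma card_sq_add_mul_sq_add (hF : Fintype.card F = 2 ^ m) (hm : m ≠ 0) {s : F} (hs : s ≠ 0)
    (hs1 : s + 1 ≠ 0) (y : F) :
    (#{r : F | (r ^ 2 + r) * ((s + r) ^ 2 + (s + r)) = y} : ℤ) =
      (1 + traceSign m (y / s ^ 2)) * (1 + traceSign m (y / (s + 1) ^ 2)) := by
  have h2 : (2 : F) = 0 := CharTwo.two_eq_zero
  rw [← card_sq_add_mul_eq hF hm hs, ← card_sq_add_mul_eq hF hm hs1, ← Nat.cast_mul,
    ← card_product]
  congr 1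
  refine card_nbij' (fun r => (r ^ 2 + (s + 1) * r, r ^ 2 + s * r)) (fun p => p.1 + p.2) ?_ ?_ ?_ ?_
  · intro r hr
    simp only [mem_coe, mem_filter, mem_univ, true_and, mem_product] at hr ⊢
    constructor
    · linear_combination hr
    · linear_combination hr + (-1*s*r^2 + -1*r^3) * h2
  · rintro ⟨p, q⟩ hp
    simp only [mem_coe, mem_filter, mem_univ, true_and, mem_product] at hp ⊢
    obtain ⟨hp, hq⟩ := hp
    have h1 : (p + q) ^ 2 + (s + 1) * (p + q) = p := by
      linear_combination hp + hq + (p*q + y) * h2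
    have h3 : (p + q) * (p + q + s + 1) * ((p + q) * (p + q + s + 1) + s) = y := by
      rw [← hp]
      linear_combination ((p + q) * (p + q + s + 1) + p + s) * h1
    linear_combination h3
  · intro r _
    simp only
    linear_combination (r ^ 2 + s * r) * h2
  · rintro ⟨p, q⟩ hp
    simp only [mem_coe, mem_filter, mem_univ, true_and, mem_product] at hp
    obtain ⟨hp, hq⟩ := hp
    refine Prod.ext ?_ ?_
    · simp only
      linear_combination hp + hq + (p*q + y) * h2
    · simp only
      linear_combination hp + hq + (p*q + -1*q + y) * h2

lemma card_triples_eq (hF : Fintype.card F = 2 ^ m) (hm : m ≠ 0) {l : F} (hl : l ≠ 0) (a : F) :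
    (#{p : F × F × F | (p.1 ^ 2 + p.1) * ((p.2.1 ^ 2 + p.2.1) *
      ((p.1 + p.2.1) ^ 2 + (p.1 + p.2.1))) = l ∧
      p.2.2 ^ 2 + p.2.2 = a + (p.1 + p.2.1) * (p.1 + 1) * (p.2.1 + 1)} : ℤ) +
      8 * (1 + traceSign m a) =
    ∑ s : F, (1 + traceSign m (l / (s ^ 3 * (s + 1)))) *
      (1 + traceSign m (l / (s * (s + 1) ^ 3))) * (1 + traceSign m (a + l / (s ^ 2 + s))) := by
  have h2 : (2 : F) = 0 := CharTwo.two_eq_zero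
  set f : F → ℤ := fun s => (1 + traceSign m (l / (s ^ 3 * (s + 1)))) *
      (1 + traceSign m (l / (s * (s + 1) ^ 3))) * (1 + traceSign m (a + l / (s ^ 2 + s))) with hf
  have hf0 : f 0 = 4 * (1 + traceSign m a) := by
    simp [hf, traceSign_zero_right]
  have hf1 : f 1 = 4 * (1 + traceSign m a) := by
    have h11 : (1 : F) + 1 = 0 := CharTwo.add_self_eq_zero 1
    simp [hf, h11, traceSign_zero_right]
  rw [← add_sum_erase univ f (mem_univ 0),
    ← add_sum_erase _ f (mem_erase.2 ⟨one_ne_zero, mem_univ (1 : F)⟩),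
    hf0, hf1]
  suffices h : (#{p : F × F × F | (p.1 ^ 2 + p.1) * ((p.2.1 ^ 2 + p.2.1) *
      ((p.1 + p.2.1) ^ 2 + (p.1 + p.2.1))) = l ∧
      p.2.2 ^ 2 + p.2.2 = a + (p.1 + p.2.1) * (p.1 + 1) * (p.2.1 + 1)} : ℤ) =
      ∑ s ∈ (univ.erase (0 : F)).erase 1, f s by
    rw [h]; ring
  rw [card_eq_sum_card_fiberwise (f := Prod.fst) (t := (univ.erase (0 : F)).erase 1)]
  · push_cast
    refine sum_congr rfl fun s hs => ?_
    simp only [mem_erase, mem_univ, and_true] at hs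
    have hs1 : s + 1 ≠ 0 := fun h => hs.1 (by linear_combination h - h2)
    have hss : s ^ 2 + s ≠ 0 := by
      rw [show s ^ 2 + s = s * (s + 1) by ring]; exact mul_ne_zero hs.2 hs1
    rw [card_eq_sum_card_fiberwise (f := fun p => p.2.1)
      (t := {r : F | (r ^ 2 + r) * ((s + r) ^ 2 + (s + r)) = l / (s ^ 2 + s)})]
    · push_cast
      rw [sum_congr rfl (g := fun _ => 1 + traceSign m (a + l / (s ^ 2 + s)))]
      · rw [sum_const, nsmul_eq_mul, card_sq_add_mul_sq_add hF hm hs.2 hs1]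
        simp only [hf]
        rw [show s ^ 2 + s = s * (s + 1) by ring, div_div, div_div,
          show s * (s + 1) * s ^ 2 = s ^ 3 * (s + 1) by ring,
          show s * (s + 1) * (s + 1) ^ 2 = s * (s + 1) ^ 3 by ring]
      · intro r hr
        rw [mem_filter] at hr
        rw [← hr.2, show a + (r ^ 2 + r) * ((s + r) ^ 2 + (s + r)) =
          (a + (s + r) * (s + 1) * (r + 1)) +
            (((s + r) * (r + 1)) ^ 2 + (s + r) * (r + 1)) by
            linear_combination (-1*s^2*r + -1*s^2 + -1*s*r^2 + -2*s*r + -1*s + -1*r^2 + -1*r) * h2,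
          traceSign_add_sq_add hF, ← card_sq_add_eq hF hm]
        congr 1
        refine card_nbij' (fun p => p.2.2) (fun x => (s, r, x)) ?_ ?_ ?_ ?_
        · rintro ⟨s', r', x⟩ hp
          simp only [mem_coe, mem_filter, mem_univ, true_and] at hp ⊢
          obtain ⟨⟨⟨-, h⟩, rfl⟩, rfl⟩ := hp
          exact h
        · intro x hx
          simp only [mem_coe, mem_filter, mem_univ, true_and] at hx ⊢
          refine ⟨⟨⟨?_, hx⟩, trivial⟩, trivial⟩
          rw [hr.2, mul_div_cancel₀ l hss]
        · rintro ⟨s', r', x⟩ hp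
          simp only [mem_coe, mem_filter, mem_univ, true_and] at hp ⊢
          obtain ⟨⟨⟨-, h⟩, rfl⟩, rfl⟩ := hp
          rfl
        · intro x _
          rfl
    · rintro ⟨s', r', x⟩ hp
      simp only [mem_coe, mem_filter, mem_univ, true_and] at hp ⊢
      obtain ⟨⟨h, -⟩, rfl⟩ := hp
      rw [eq_div_iff hss, ← h]
      ring
  · rintro ⟨s, r, x⟩ hp
    simp only [mem_coe, mem_filter, mem_univ, true_and, mem_erase, and_true] at hp ⊢
    obtain ⟨h, -⟩ := hp
    constructor
    · rintro rfl
      exact hl (by linear_combination -h + (r ^ 2 + r) * ((1 + r) ^ 2 + (1 + r)) * h2)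
    · rintro rfl
      exact hl (by rw [← h]; ring)

end Triples

section CharacterSums

open Finset

variable {F : Type*} [Field F] [Fintype F] [DecidableEq F] [CharP F 2] {m : ℕ}

omit [CharP F 2] in
lemma sum_traceSign_laurentCubic (α β γ : F) :
    ∑ x : F, traceSign m (laurentCubic α β γ x) =
      1 + ∑ x ∈ univ.erase 0, traceSign m (laurentCubic α β γ x) := by
  rw [← add_sum_erase univ _ (mem_univ 0)]
  simp [laurentCubic, traceSign_zero_right]

omit [DecidableEq F] [CharP F 2] in
lemma sum_comp_add_one (f : F → ℤ) : ∑ s, f (s + 1) = ∑ s, f s :=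
  Equiv.sum_comp (Equiv.addRight (1 : F)) f

omit [DecidableEq F] [CharP F 2] in
lemma sum_comp_inv (f : F → ℤ) : ∑ s, f s⁻¹ = ∑ s, f s := Equiv.sum_comp (Equiv.inv F) f

lemma sum_traceSign_div_cube_mul (l : F) :
    ∑ s : F, traceSign m (l / (s ^ 3 * (s + 1))) =
      1 + ∑ x ∈ univ.erase 0, traceSign m (laurentCubic l 0 l x) := by
  have h2 : (2 : F) = 0 := CharTwo.two_eq_zero
  rw [← sum_traceSign_laurentCubic, ← sum_comp_inv, ← sum_comp_add_one]
  refine sum_congr rfl fun z _ => ?_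
  congr 1
  rw [laurentCubic]
  rcases eq_or_ne z 0 with rfl | hz
  · simp [CharTwo.add_self_eq_zero]
  rcases eq_or_ne (z + 1) 0 with h | h
  · obtain rfl : z = 1 := by linear_combination h - h2
    simp [h, CharTwo.add_self_eq_zero]
  have h3 : (z + 1)⁻¹ + 1 = z * (z + 1)⁻¹ := by
    field_simp
    linear_combination h2
  rw [h3]
  field_simp
  linear_combination l * (2 * z ^ 3 + 3 * z ^ 2 + 2 * z) * h2

lemma sum_traceSign_div_mul_cube (l : F) :
    ∑ s : F, traceSign m (l / (s * (s + 1) ^ 3)) =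
      1 + ∑ x ∈ univ.erase 0, traceSign m (laurentCubic l 0 l x) := by
  rw [← sum_traceSign_div_cube_mul, ← sum_comp_add_one]
  refine sum_congr rfl fun z _ => ?_
  rw [add_assoc, CharTwo.add_self_eq_zero, add_zero, mul_comm]

omit [Fintype F] [DecidableEq F] in
lemma div_cube_mul_add_div_mul_cube (l s : F) :
    l / (s ^ 3 * (s + 1)) + l / (s * (s + 1) ^ 3) = l * ((s ^ 2 + s)⁻¹) ^ 3 := by
  have h2 : (2 : F) = 0 := CharTwo.two_eq_zero
  rcases eq_or_ne s 0 with rfl | hs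
  · simp
  rcases eq_or_ne (s + 1) 0 with h | h
  · obtain rfl : s = 1 := by linear_combination h - h2
    simp [h]
  rw [show s ^ 2 + s = s * (s + 1) by ring]
  field_simp
  linear_combination l * (s ^ 2 + s) * h2

omit [Fintype F] [DecidableEq F] in
lemma div_cube_mul_add_div (l s : F) :
    l / (s ^ 3 * (s + 1)) + l / (s ^ 2 + s) = l * s⁻¹ ^ 3 + l * s⁻¹ ^ 2 := by
  have h2 : (2 : F) = 0 := CharTwo.two_eq_zero
  rcases eq_or_ne s 0 with rfl | hs
  · simp
  rcases eq_or_ne (s + 1) 0 with h | h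
  · obtain rfl : s = 1 := by linear_combination h - h2
    simp [h, CharTwo.add_self_eq_zero]
  rw [show s ^ 2 + s = s * (s + 1) by ring]
  field_simp
  linear_combination -l * s * h2

variable (hF : Fintype.card F = 2 ^ m) (hm : m ≠ 0)
include hF hm

lemma sum_traceSign_comp_inv_sq_add (f : F → F) :
    ∑ s : F, traceSign m (f (s ^ 2 + s)⁻¹) =
      ∑ x : F, traceSign m (f x) + ∑ x : F, traceSign m (f x + x⁻¹) := by
  rw [sum_comp_sq_add hF hm (fun y => traceSign m (f y⁻¹)), ← sum_comp_inv, ← sum_add_distrib]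
  refine sum_congr rfl fun y _ => ?_
  rw [traceSign_add' hF, inv_inv]
  ring

lemma sum_product_eq {l : F} (hl : l ≠ 0) (a : F) :
    ∑ s : F, (1 + traceSign m (l / (s ^ 3 * (s + 1)))) *
      (1 + traceSign m (l / (s * (s + 1) ^ 3))) * (1 + traceSign m (a + l / (s ^ 2 + s))) =
    2 ^ m + 3 + 2 * traceSign m a
      + 2 * ∑ x ∈ univ.erase 0, traceSign m (laurentCubic l 0 l x)
      + ∑ x, traceSign m (l * x ^ 3 + 0 * x ^ 2 + 0 * x)
      + ∑ x ∈ univ.erase 0, traceSign m (laurentCubic l 0 1 x)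
      + traceSign m a * (∑ x ∈ univ.erase 0, traceSign m (laurentCubic 0 1 l x)
        + 2 * ∑ x, traceSign m (l * x ^ 3 + l * x ^ 2 + 0 * x)
        + ∑ x, traceSign m (l * x ^ 3 + 0 * x ^ 2 + l * x)
        + ∑ x ∈ univ.erase 0, traceSign m (laurentCubic l l 1 x)) := by
  have hab : ∑ s : F, traceSign m (l / (s ^ 3 * (s + 1)) + l / (s * (s + 1) ^ 3)) =
      ∑ x, traceSign m (l * x ^ 3 + 0 * x ^ 2 + 0 * x) +
        (1 + ∑ x ∈ univ.erase 0, traceSign m (laurentCubic l 0 1 x)) := by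
    simp only [div_cube_mul_add_div_mul_cube]
    rw [sum_traceSign_comp_inv_sq_add hF hm (fun x => l * x ^ 3), ← sum_traceSign_laurentCubic]
    simp [laurentCubic]
  have hk : ∑ s : F, traceSign m (l / (s ^ 2 + s)) =
      1 + ∑ x ∈ univ.erase 0, traceSign m (laurentCubic 0 1 l x) := by
    simp only [div_eq_mul_inv]
    rw [sum_traceSign_comp_inv_sq_add hF hm (fun x => l * x), ← sum_traceSign_laurentCubic,
      ← sum_comp_inv (fun x => traceSign m (l * x + x⁻¹))]
    have h0 : ∑ x, traceSign m (l * x) = 0 := by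
      simpa only [mul_comm l] using sum_traceSign_mul_eq_zero hF hm hl
    simp [laurentCubic, add_comm, h0]
  have hak : ∑ s : F, traceSign m (l / (s ^ 3 * (s + 1)) + l / (s ^ 2 + s)) =
      ∑ x, traceSign m (l * x ^ 3 + l * x ^ 2 + 0 * x) := by
    simp only [div_cube_mul_add_div]
    rw [sum_comp_inv (fun x => traceSign m (l * x ^ 3 + l * x ^ 2))]
    simp
  have hbk : ∑ s : F, traceSign m (l / (s * (s + 1) ^ 3) + l / (s ^ 2 + s)) =
      ∑ x, traceSign m (l * x ^ 3 + l * x ^ 2 + 0 * x) := by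
    rw [← hak, ← sum_comp_add_one]
    refine sum_congr rfl fun s _ => ?_
    rw [show (s + 1) ^ 2 + (s + 1) = s ^ 2 + s by
      linear_combination (s + 1) * CharTwo.two_eq_zero (R := F), add_assoc s 1 1,
      CharTwo.add_self_eq_zero, add_zero, mul_comm (s + 1)]
  have habk : ∑ s : F, traceSign m (l / (s ^ 3 * (s + 1)) + l / (s * (s + 1) ^ 3) +
      l / (s ^ 2 + s)) = ∑ x, traceSign m (l * x ^ 3 + 0 * x ^ 2 + l * x) +
        (1 + ∑ x ∈ univ.erase 0, traceSign m (laurentCubic l l 1 x)) := by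
    simp only [div_cube_mul_add_div_mul_cube]
    simp only [div_eq_mul_inv]
    rw [sum_traceSign_comp_inv_sq_add hF hm (fun x => l * x ^ 3 + l * x),
      ← sum_traceSign_laurentCubic]
    simp [laurentCubic]
  have hexp : ∀ s : F, (1 + traceSign m (l / (s ^ 3 * (s + 1)))) *
      (1 + traceSign m (l / (s * (s + 1) ^ 3))) * (1 + traceSign m (a + l / (s ^ 2 + s))) =
      1 + traceSign m (l / (s ^ 3 * (s + 1))) + traceSign m (l / (s * (s + 1) ^ 3)) +
      traceSign m (l / (s ^ 3 * (s + 1)) + l / (s * (s + 1) ^ 3)) +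
      traceSign m a * (traceSign m (l / (s ^ 2 + s)) +
        traceSign m (l / (s ^ 3 * (s + 1)) + l / (s ^ 2 + s)) +
        traceSign m (l / (s * (s + 1) ^ 3) + l / (s ^ 2 + s)) +
        traceSign m (l / (s ^ 3 * (s + 1)) + l / (s * (s + 1) ^ 3) + l / (s ^ 2 + s))) := by
    intro s
    simp only [traceSign_add' hF]
    ring
  simp only [hexp, sum_add_distrib, ← mul_sum, sum_traceSign_div_cube_mul,
    sum_traceSign_div_mul_cube, hab, hk, hak, hbk, habk]
  rw [sum_const, card_univ, hF]
  simp only [nsmul_eq_mul, Nat.cast_pow, Nat.cast_ofNat, mul_one]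
  ring

end CharacterSums

section Bounds

open Finset

variable {F : Type*} [Field F] [Fintype F] [DecidableEq F] [CharP F 2] {m : ℕ}

lemma exists_forall_abs_sum_traceSign_cubic_le (hF : Fintype.card F = 2 ^ m) (hm : 2 ≤ m) :
    ∃ w : ℤ, (∀ l : F, l ≠ 0 → ∀ b c, |∑ x, traceSign m (l * x ^ 3 + b * x ^ 2 + c * x)| ≤ w) ∧
      4 * ⌊4 * √(2 ^ m : ℝ)⌋ + 4 * w ≤ 12 * ⌊2 * √(2 ^ m : ℝ)⌋ := by
  have hm0 : m ≠ 0 := by omega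
  rcases Nat.even_or_odd' m with ⟨k, rfl | rfl⟩
  · have hsqrt : √(2 ^ (2 * k) : ℝ) = 2 ^ k := by
      rw [mul_comm, pow_mul, Real.sqrt_sq (by positivity)]
    refine ⟨2 * 2 ^ k, fun l hl b c => ?_, ?_⟩
    · refine abs_le_of_sq_le_sq ((sq_sum_traceSign_cubic hF hm0 hl b c).trans ?_) (by positivity)
      have h4 : (#{h : F | h = 0 ∨ h ^ 3 = l⁻¹} : ℤ) ≤ 4 := by
        exact_mod_cast card_nthRoots_toFinset_three_le l
      calc (2 : ℤ) ^ (2 * k) * #{h : F | h = 0 ∨ h ^ 3 = l⁻¹} ≤ 2 ^ (2 * k) * 4 := by gcongr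
        _ = (2 * 2 ^ k) ^ 2 := by ring
    · rw [hsqrt, show (4 : ℝ) * 2 ^ k = ((4 * 2 ^ k : ℤ) : ℝ) by push_cast; rfl,
        show (2 : ℝ) * 2 ^ k = ((2 * 2 ^ k : ℤ) : ℝ) by push_cast; rfl, Int.floor_intCast,
        Int.floor_intCast]
      linarith
  · have h1 : (√(2 ^ (2 * k + 1) : ℝ)) ^ 2 = 2 * (2 ^ k) ^ 2 := by
      rw [Real.sq_sqrt (by positivity)]
      ring
    have h2 : (2 : ℝ) ≤ 2 ^ k := by
      calc (2 : ℝ) = 2 ^ 1 := by norm_num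
        _ ≤ 2 ^ k := pow_le_pow_right₀ (by norm_num) (by omega)
    refine ⟨2 ^ (k + 1), fun l hl b c => ?_, ?_⟩
    · refine abs_le_of_sq_le_sq ((sq_sum_traceSign_cubic hF hm0 hl b c).trans ?_) (by positivity)
      have h4 : (#{h : F | h = 0 ∨ h ^ 3 = l⁻¹} : ℤ) ≤ 2 := by
        exact_mod_cast card_cube_roots_le_of_odd hF (odd_two_mul_add_one k) hl
      calc (2 : ℤ) ^ (2 * k + 1) * #{h : F | h = 0 ∨ h ^ 3 = l⁻¹} ≤ 2 ^ (2 * k + 1) * 2 := by gcongr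
        _ = (2 ^ (k + 1)) ^ 2 := by ring
    · set t := √(2 ^ (2 * k + 1) : ℝ)
      have ht : 0 ≤ t := Real.sqrt_nonneg _
      have hfl : (2 : ℤ) ^ (k + 1) + 1 ≤ ⌊2 * t⌋ := by
        rw [Int.le_floor]
        push_cast
        rw [pow_succ]
        by_contra! h
        nlinarith
      have h4 : ⌊4 * t⌋ ≤ 2 * ⌊2 * t⌋ + 1 := by
        rw [← Int.lt_add_one_iff, Int.floor_lt]
        push_cast
        linarith [Int.lt_floor_add_one (2 * t)]
      linarith

theorem twentyfour_mul_ncard_bounds (hF : Fintype.card F = 2 ^ m) (hm : 2 ≤ m) {A B : F}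
    (hlam : B + A ^ 2 + A + 1 ≠ 0) :
    (2 ^ m - 11 - 13 * ⌊2 * √(2 ^ m : ℝ)⌋ : ℤ) ≤
      24 * (Set.ncard {s : Finset F | #s = 4 ∧ ∑ x ∈ s, x = 1 ∧ ∑ x ∈ s, x ^ 3 = A ∧
        ∑ x ∈ s, x ^ 5 = B} : ℤ) ∧
    24 * (Set.ncard {s : Finset F | #s = 4 ∧ ∑ x ∈ s, x = 1 ∧ ∑ x ∈ s, x ^ 3 = A ∧
        ∑ x ∈ s, x ^ 5 = B} : ℤ) ≤ 2 ^ m + 1 + 13 * ⌊2 * √(2 ^ m : ℝ)⌋ := by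
  have hm0 : m ≠ 0 := by omega
  have hN := congrArg (Nat.cast (R := ℤ))
    ((twentyfour_mul_ncard A B).trans (card_injective_eq_card_triples rfl hlam))
  rw [Nat.cast_mul, Nat.cast_ofNat] at hN
  rw [hN]
  have hT := card_triples_eq hF hm0 hlam (A + 1)
  rw [sum_product_eq hF hm0 hlam] at hT
  obtain ⟨w, hw, hnum⟩ := exists_forall_abs_sum_traceSign_cubic_le hF hm
  generalize B + A ^ 2 + A + 1 = l at *
  have h1 := abs_le.1 (abs_sum_traceSign_cubic_le hF hm0 hlam 0 l)
  have h2 := abs_le.1 (hw l hlam 0 0)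
  have h3 := abs_le.1 (abs_sum_traceSign_cubic_le hF hm0 hlam 0 1)
  have h4 := abs_le.1 (abs_sum_traceSign_linear_le hF hm0 (one_ne_zero (α := F)) l)
  have h5 := abs_le.1 (hw l hlam l 0)
  have h6 := abs_le.1 (hw l hlam 0 l)
  have h7 := abs_le.1 (abs_sum_traceSign_cubic_le hF hm0 hlam l 1)
  rcases traceSign_eq_one_or m (A + 1) with ha | ha <;> rw [ha] at hT <;> constructor <;> linarith

end Bounds

lemma card_galoisField_two_le_two {m : ℕ} (hm : m < 2) : Nat.card (GaloisField 2 m) ≤ 2 := by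
  interval_cases m
  · have : Polynomial.IsSplittingField (ZMod 2) (ZMod 2)
        (Polynomial.X ^ 2 ^ 0 - Polynomial.X : Polynomial (ZMod 2)) := by
      rw [pow_zero, pow_one, sub_self, ← Polynomial.C_0]
      exact Polynomial.isSplittingField_C 0
    have h : Nat.card (ZMod 2) = Nat.card (GaloisField 2 0) :=
      Nat.card_congr (Polynomial.IsSplittingField.algEquiv (ZMod 2)
        (Polynomial.X ^ 2 ^ 0 - Polynomial.X : Polynomial (ZMod 2))).toEquiv
    simp [← h]
  · rw [GaloisField.card 2 1 one_ne_zero]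
    norm_num

/-- Hasse–Weil–Serre bounds for `N(A,B)` when
`λ = B + A² + A + 1 ≠ 0`:
`(q − 11 − 13⌊2√q⌋)/24 ≤ N(A,B) ≤ (q + 1 + 13⌊2√q⌋)/24` for `q = 2^m`. -/
theorem N_bounds_weil
    (m : ℕ) (A B : GaloisField 2 m)
    (hlam : B + A ^ 2 + A + 1 ≠ 0) :
    ((2 ^ m : ℝ) - 11 - 13 * ⌊2 * Real.sqrt (2 ^ m)⌋) / 24 ≤
      (Set.ncard {s : Finset (GaloisField 2 m) | s.card = 4 ∧
        (∑ x ∈ s, x) = 1 ∧ (∑ x ∈ s, x ^ 3) = A ∧ (∑ x ∈ s, x ^ 5) = B} : ℝ) ∧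
    (Set.ncard {s : Finset (GaloisField 2 m) | s.card = 4 ∧
        (∑ x ∈ s, x) = 1 ∧ (∑ x ∈ s, x ^ 3) = A ∧ (∑ x ∈ s, x ^ 5) = B} : ℝ) ≤
      ((2 ^ m : ℝ) + 1 + 13 * ⌊2 * Real.sqrt (2 ^ m)⌋) / 24 := by
  classical
  rcases le_or_gt 2 m with hm | hm
  · have : Fintype (GaloisField 2 m) := Fintype.ofFinite _
    have hF : Fintype.card (GaloisField 2 m) = 2 ^ m := by
      rw [← Nat.card_eq_fintype_card, GaloisField.card 2 m (by omega)]
    obtain ⟨h1, h2⟩ := twentyfour_mul_ncard_bounds hF hm hlam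
    rw [div_le_iff₀ (by norm_num), le_div_iff₀ (by norm_num)]
    constructor
    · rw [mul_comm _ (24 : ℝ)]
      exact_mod_cast h1
    · rw [mul_comm _ (24 : ℝ)]
      exact_mod_cast h2
  · have hcard := card_galoisField_two_le_two hm
    have hempty : {s : Finset (GaloisField 2 m) | s.card = 4 ∧ (∑ x ∈ s, x) = 1 ∧
        (∑ x ∈ s, x ^ 3) = A ∧ (∑ x ∈ s, x ^ 5) = B} = ∅ := by
      rw [Set.eq_empty_iff_forall_notMem]
      rintro s ⟨hs, -⟩
      have : Fintype (GaloisField 2 m) := Fintype.ofFinite _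
      have h := s.card_le_univ
      rw [← Nat.card_eq_fintype_card, hs] at h
      omega
    have hfl : (0 : ℝ) ≤ ⌊2 * √(2 ^ m : ℝ)⌋ := by
      exact_mod_cast Int.floor_nonneg.2 (by positivity)
    have hq : (2 : ℝ) ^ m ≤ 2 := by interval_cases m <;> norm_num
    rw [hempty, Set.ncard_empty, Nat.cast_zero]
    constructor
    · linarith
    · positivity
end
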